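/- Let p ∈ [1,2] and let H be a finitely generated infinite group. Then the equivariant L_p-compression exponent of the wreath product H ≀ ℤ satisfies α_p^#(H ≀ ℤ) = min{ α_p^#(H) / (α_p^#(H) + (1 − 1/p)), α_p^#(H) }. -/

import Mathlib

open scoped BigOperators ENNReal

noncomputable section

/-- Word length of `g` with respect to a generating set `S`. -/
def wordLength {G : Type*} [Group G] (S : Set G) (g : G) : ℕ :=
  sInf {n : ℕ | ∃ l : List G, (∀ x ∈ l, x ∈ S) ∧ l.length = n ∧ l.prod = g}

/-- Left-invariant word distance associated with the generating set `S`. -/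
def wordDist {G : Type*} [Group G] (S : Set G) (x y : G) : ℕ :=
  wordLength S (x⁻¹ * y)

/-- `S` is a finite symmetric generating set of `G`. -/
structure IsSymmGen {G : Type*} [Group G] (S : Finset G) : Prop where
  symm : ∀ g ∈ S, g⁻¹ ∈ S
  gen : Subgroup.closure (S : Set G) = ⊤

/-- The Lebesgue space `L_p([0,1])`. -/
abbrev Lp01 (p : ℝ) : Type :=
  ↥(MeasureTheory.Lp (α := ℝ) ℝ (ENNReal.ofReal p)
      (MeasureTheory.volume.restrict (Set.Icc (0:ℝ) 1)))

/-- The compression function `ρ_Ψ` of a map `Ψ` from a group with word metric (associated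
to the generating set `S`) to a normed group. -/
def compressionFn {G : Type*} [Group G] (S : Set G) {E : Type*} [AddGroup E] [Norm E]
    (Ψ : G → E) (t : ℝ) : ℝ :=
  sInf {r : ℝ | ∃ x y : G, t ≤ (wordDist S x y : ℝ) ∧ r = ‖Ψ x - Ψ y‖}

/-- `Ψ` is `C`-Lipschitz for the word metric of `S`. -/
def LipschitzWord {G : Type*} [Group G] (S : Set G) {E : Type*} [AddGroup E] [Norm E]
    (C : ℝ) (Ψ : G → E) : Prop :=
  ∀ x y : G, ‖Ψ x - Ψ y‖ ≤ C * (wordDist S x y : ℝ)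

/-- `Ψ : G → E` is equivariant: it is the orbit map of an action of `G` on `E` by
(necessarily affine, by the Mazur–Ulam theorem) isometries. -/
def IsEquivariant {G : Type*} [Group G] {E : Type*} [AddGroup E] [Norm E]
    (Ψ : G → E) : Prop :=
  ∃ A : G → E → E,
    (∀ x : E, A 1 x = x) ∧
    (∀ g h : G, ∀ x : E, A (g * h) x = A g (A h x)) ∧
    (∀ g : G, ∀ x y : E, ‖A g x - A g y‖ = ‖x - y‖) ∧
    (∀ g : G, Ψ g = A g (Ψ 1))

/-- The compression exponent `α(Ψ)` of a map `Ψ`. -/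
def compExp {G : Type*} [Group G] (S : Set G) {E : Type*} [AddGroup E] [Norm E]
    (Ψ : G → E) : ℝ :=
  sSup {α : ℝ | 0 ≤ α ∧ ∃ c : ℝ, 0 < c ∧
    ∀ t : ℝ, 1 ≤ t → c * t ^ α ≤ compressionFn S Ψ t}

/-- The `L_p`-compression exponent `α_p^*(G)` (with respect to the generating set `S`). -/
def alphaStar (G : Type*) [Group G] (S : Set G) (p : ℝ) : ℝ :=
  sSup {a : ℝ | ∃ Ψ : G → Lp01 p,
    (∃ C : ℝ, 0 < C ∧ LipschitzWord S C Ψ) ∧ a = compExp S Ψ}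

/-- The equivariant `L_p`-compression exponent `α_p^#(G)` (with respect to `S`). -/
def alphaSharp (G : Type*) [Group G] (S : Set G) (p : ℝ) : ℝ :=
  sSup {a : ℝ | ∃ Ψ : G → Lp01 p,
    LipschitzWord S 1 Ψ ∧ IsEquivariant Ψ ∧ a = compExp S Ψ}

/-- `(g₁, g₂)` is an equivariant `L_p`-compression gap of `(G, S)`. -/
def IsEquivCompressionGap {G : Type*} [Group G] (S : Set G) (p : ℝ)
    (g₁ g₂ : ℝ → ℝ) : Prop :=
  (∀ φ : G → Lp01 p, LipschitzWord S 1 φ → IsEquivariant φ →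
    ∀ t : ℝ, 1 ≤ t → compressionFn S φ t ≤ g₂ t) ∧
  (∃ Ψ : G → Lp01 p, LipschitzWord S 1 Ψ ∧ IsEquivariant Ψ ∧
    ∀ t : ℝ, 1 ≤ t → g₁ t ≤ compressionFn S Ψ t)

/-- The group of finitely supported configurations `ℤ → H`. -/
def lamps (H : Type*) [Group H] : Subgroup (ℤ → H) where
  carrier := {f | (Function.mulSupport f).Finite}
  one_mem' := by
    have h : Function.mulSupport (1 : ℤ → H) ⊆ ∅ := by
      intro x hx
      simp [Function.mem_mulSupport] at hx
    exact Set.finite_empty.subset h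
  mul_mem' := by
    intro a b ha hb
    simp only [Set.mem_setOf_eq] at *
    exact (ha.union hb).subset (Function.mulSupport_mul a b)
  inv_mem' := by
    intro a ha
    simp only [Set.mem_setOf_eq] at *
    have : Function.mulSupport (a⁻¹) ⊆ Function.mulSupport a := by
      intro x hx
      simp only [Function.mem_mulSupport, Pi.inv_apply, ne_eq, inv_eq_one] at hx
      exact hx
    exact ha.subset this

lemma mem_lamps {H : Type*} [Group H] {f : ℤ → H} :
    f ∈ lamps H ↔ (Function.mulSupport f).Finite := Iff.rfl

/-- Translation by `n` as an automorphism of the group of finitely supported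
configurations. -/
def shiftMulEquiv (H : Type*) [Group H] (n : ℤ) : lamps H ≃* lamps H where
  toFun f := ⟨fun x => (f : ℤ → H) (x - n), by
    apply Set.Finite.subset (Set.Finite.image (· + n) f.2)
    intro x hx
    exact ⟨x - n, hx, by ring⟩⟩
  invFun f := ⟨fun x => (f : ℤ → H) (x + n), by
    apply Set.Finite.subset (Set.Finite.image (· - n) f.2)
    intro x hx
    exact ⟨x + n, hx, by ring⟩⟩
  left_inv f := by
    apply Subtype.ext
    funext x
    simp
  right_inv f := by
    apply Subtype.ext
    funext x
    simp
  map_mul' f g := rfl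

/-- The shift action of `ℤ` on finitely supported configurations. -/
def shiftHom (H : Type*) [Group H] : Multiplicative ℤ →* MulAut (lamps H) where
  toFun n := shiftMulEquiv H (Multiplicative.toAdd n)
  map_one' := by
    refine MulEquiv.ext fun f => ?_
    refine Subtype.ext (funext fun x => ?_)
    show (f : ℤ → H) (x - (0:ℤ)) = (f : ℤ → H) x
    simp
  map_mul' a b := by
    refine MulEquiv.ext fun f => ?_
    refine Subtype.ext (funext fun x => ?_)
    show (f : ℤ → H) (x - (Multiplicative.toAdd a + Multiplicative.toAdd b))
      = (f : ℤ → H) (x - Multiplicative.toAdd a - Multiplicative.toAdd b)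
    have h : x - (Multiplicative.toAdd a + Multiplicative.toAdd b)
        = x - Multiplicative.toAdd a - Multiplicative.toAdd b := by ring
    rw [h]

/-- The wreath product `H ≀ ℤ`. -/
abbrev WreathZ (H : Type*) [Group H] :=
  SemidirectProduct ↥(lamps H) (Multiplicative ℤ) (shiftHom H)

/-- The configuration equal to `h` at position `j` and to the identity elsewhere. -/
def deltaFn {H : Type*} [Group H] (j : ℤ) (h : H) : ↥(lamps H) :=
  ⟨fun x => if x = j then h else 1, by
    apply Set.Finite.subset (Set.finite_singleton j)
    intro x hx
    simp only [Function.mem_mulSupport] at hx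
    by_contra hxj
    exact hx (if_neg (by simpa using hxj))⟩

/-- The shift generator `t = (𝟙, 1)` of `H ≀ ℤ`. -/
def shiftGen (H : Type*) [Group H] : WreathZ H :=
  SemidirectProduct.inr (Multiplicative.ofAdd 1)


/-! Word length basics -/

section WL
variable {G : Type*} [Group G] {S : Finset G}

lemma exists_list_gen (hS : IsSymmGen S) (g : G) :
    ∃ l : List G, (∀ x ∈ l, x ∈ (S : Set G)) ∧ l.prod = g := by
  have hg : g ∈ Subgroup.closure (S : Set G) := by rw [hS.gen]; trivial
  induction hg using Subgroup.closure_induction with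
  | mem x hx => exact ⟨[x], by simpa using hx, by simp⟩
  | one => exact ⟨[], by simp, by simp⟩
  | mul x y _ _ hx hy =>
    obtain ⟨l, hl, rfl⟩ := hx
    obtain ⟨l', hl', rfl⟩ := hy
    refine ⟨l ++ l', ?_, by simp⟩
    intro z hz
    rcases List.mem_append.1 hz with h | h
    · exact hl z h
    · exact hl' z h
  | inv x _ hx =>
    obtain ⟨l, hl, rfl⟩ := hx
    refine ⟨(l.map fun y => y⁻¹).reverse, ?_, ?_⟩
    · intro z hz
      simp only [List.mem_reverse, List.mem_map] at hz
      obtain ⟨y, hy, rfl⟩ := hz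
      exact hS.symm y (hl y hy)
    · rw [List.prod_inv_reverse]

lemma wl_le_of_list {l : List G} (hl : ∀ x ∈ l, x ∈ (S : Set G)) :
    wordLength (S : Set G) l.prod ≤ l.length :=
  Nat.sInf_le ⟨l, hl, rfl, rfl⟩

lemma wl_spec (hS : IsSymmGen S) (g : G) :
    ∃ l : List G, (∀ x ∈ l, x ∈ (S : Set G)) ∧ l.length = wordLength (S : Set G) g
      ∧ l.prod = g := by
  obtain ⟨l, hl, h⟩ := exists_list_gen hS g
  exact Nat.sInf_mem (s := {n : ℕ | ∃ l : List G, (∀ x ∈ l, x ∈ (S : Set G)) ∧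
    l.length = n ∧ l.prod = g}) ⟨_, l, hl, rfl, h⟩

lemma wl_one : wordLength (S : Set G) 1 = 0 := by
  have := wl_le_of_list (S := S) (l := []) (by simp)
  simpa using this

lemma wl_mul_le (hS : IsSymmGen S) (g h : G) :
    wordLength (S : Set G) (g * h) ≤ wordLength (S : Set G) g + wordLength (S : Set G) h := by
  obtain ⟨l, hl, e, rfl⟩ := wl_spec hS g
  obtain ⟨l', hl', e', rfl⟩ := wl_spec hS h
  rw [← e, ← e', ← List.prod_append, ← List.length_append]
  apply wl_le_of_list
  intro z hz
  rcases List.mem_append.1 hz with h | h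
  · exact hl z h
  · exact hl' z h

lemma wl_inv_le (hS : IsSymmGen S) (g : G) :
    wordLength (S : Set G) g⁻¹ ≤ wordLength (S : Set G) g := by
  obtain ⟨l, hl, e, rfl⟩ := wl_spec hS g
  rw [← e, List.prod_inv_reverse]
  refine (wl_le_of_list ?_).trans (by simp)
  intro z hz
  simp only [List.mem_reverse, List.mem_map] at hz
  obtain ⟨y, hy, rfl⟩ := hz
  exact hS.symm y (hl y hy)

lemma wl_inv (hS : IsSymmGen S) (g : G) :
    wordLength (S : Set G) g⁻¹ = wordLength (S : Set G) g :=
  le_antisymm (wl_inv_le hS g) (by simpa using wl_inv_le hS g⁻¹)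

lemma wl_pos (hS : IsSymmGen S) {g : G} (hg : g ≠ 1) : 1 ≤ wordLength (S : Set G) g := by
  obtain ⟨l, hl, e, h⟩ := wl_spec hS g
  rw [← e]
  rcases l with _ | ⟨a, l⟩
  · exact absurd h.symm (by simpa using hg)
  · simp

/-- subadditive functions are controlled by word length -/
lemma subadd_le (hS : IsSymmGen S) (L : G → ℝ) (h1 : L 1 ≤ 0)
    (hm : ∀ g h, L (g * h) ≤ L g + L h) :
    ∃ C : ℝ, 0 < C ∧ ∀ g, L g ≤ C * wordLength (S : Set G) g := by
  obtain ⟨C, hC⟩ := (S.finite_toSet.image L).bddAbove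
  refine ⟨max C 1, by positivity, fun g => ?_⟩
  obtain ⟨l, hl, e, rfl⟩ := wl_spec hS g
  rw [← e]
  clear e
  induction l with
  | nil => simpa using h1
  | cons a l ih =>
    have h2 := ih (fun x hx => hl x (List.mem_cons_of_mem _ hx))
    have h3 : L a ≤ max C 1 :=
      (hC ⟨a, hl a (by simp), rfl⟩).trans (le_max_left _ _)
    have h4 := hm a l.prod
    simp only [List.prod_cons, List.length_cons]
    push_cast
    linarith

lemma finite_ball (hS : IsSymmGen S) (n : ℕ) :
    {g : G | wordLength (S : Set G) g ≤ n}.Finite := by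
  have : ∀ n : ℕ, {g : G | wordLength (S : Set G) g = n}.Finite := by
    intro n
    have hf : (Set.range (fun v : Fin n → S => (List.ofFn (fun i => (v i : G))).prod)).Finite :=
      Set.finite_range _
    refine hf.subset ?_
    rintro g hg
    obtain ⟨l, hl, e, rfl⟩ := wl_spec hS g
    have e' : l.length = n := e.trans hg
    subst e'
    refine ⟨fun i => ⟨l.get i, hl _ (List.get_mem l i)⟩, ?_⟩
    simp
  have h2 : {g : G | wordLength (S : Set G) g ≤ n} =
      ⋃ k ∈ Finset.range (n+1), {g : G | wordLength (S : Set G) g = k} := by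
    ext g; simp
  rw [h2]
  exact Set.Finite.biUnion (Finset.finite_toSet _) (fun k _ => this k)

lemma exists_wl_ge [Infinite G] (hS : IsSymmGen S) (n : ℕ) :
    ∃ g : G, n ≤ wordLength (S : Set G) g := by
  by_contra! h
  exact Set.infinite_univ ((finite_ball hS n).subset (fun g _ => (h g).le))

lemma exists_wl_eq [Infinite G] (hS : IsSymmGen S) (n : ℕ) :
    ∃ g : G, wordLength (S : Set G) g = n := by
  obtain ⟨g, hg⟩ := exists_wl_ge hS n
  obtain ⟨l, hl, e, rfl⟩ := wl_spec hS g
  have h1 : wordLength (S : Set G) (l.take n).prod ≤ n := by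
    refine (wl_le_of_list (fun x hx => hl x (List.mem_of_mem_take hx))).trans ?_
    simp
  have h2 : wordLength (S : Set G) (l.drop n).prod ≤ l.length - n := by
    refine (wl_le_of_list (fun x hx => hl x (List.mem_of_mem_drop hx))).trans ?_
    simp
  have h3 := wl_mul_le hS (l.take n).prod (l.drop n).prod
  rw [List.prod_take_mul_prod_drop] at h3
  exact ⟨(l.take n).prod, by omega⟩

end WL

section Eqv
variable {G : Type*} [Group G] {E : Type*} [NormedAddCommGroup E]

lemma eqv_left {Ψ : G → E} (h : IsEquivariant Ψ) (g x y : G) :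
    ‖Ψ (g * x) - Ψ (g * y)‖ = ‖Ψ x - Ψ y‖ := by
  obtain ⟨A, h1, h2, h3, h4⟩ := h
  rw [h4 (g * x), h4 (g * y), h2, h2, h3, ← h4, ← h4]

lemma eqv_dist {Ψ : G → E} (h : IsEquivariant Ψ) (x y : G) :
    ‖Ψ x - Ψ y‖ = ‖Ψ (x⁻¹ * y) - Ψ 1‖ := by
  rw [← eqv_left h x⁻¹ x y, norm_sub_rev]; simp

lemma eqv_mul {Ψ : G → E} (h : IsEquivariant Ψ) (x y : G) :
    ‖Ψ (x * y) - Ψ 1‖ ≤ ‖Ψ x - Ψ 1‖ + ‖Ψ y - Ψ 1‖ := by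
  have := norm_sub_le_norm_sub_add_norm_sub (Ψ (x * y)) (Ψ x) (Ψ 1)
  have h2 := eqv_left h x y 1
  rw [mul_one] at h2
  linarith

lemma eqv_smul [NormedSpace ℝ E] {Ψ : G → E} (h : IsEquivariant Ψ) {r : ℝ} (hr : r ≠ 0) :
    IsEquivariant (fun g => r • Ψ g) := by
  obtain ⟨A, h1, h2, h3, h4⟩ := h
  refine ⟨fun g x => r • A g (r⁻¹ • x), ?_, ?_, ?_, ?_⟩
  · intro x; simp only; rw [h1, smul_inv_smul₀ hr]
  · intro g k x
    simp only; rw [h2, inv_smul_smul₀ hr]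
  · intro g x y
    rw [← smul_sub, norm_smul, h3, ← smul_sub, norm_smul, ← mul_assoc, ← norm_mul,
      mul_inv_cancel₀ hr]
    simp
  · intro g
    simp only
    rw [inv_smul_smul₀ hr, ← h4]

end Eqv

section Good

/-- There is an equivariant map with compression at least `c * t ^ a`. -/
def GoodExp (G : Type*) [Group G] (S : Set G) (p : ℝ) (a : ℝ) : Prop :=
  0 ≤ a ∧ ∃ Ψ : G → Lp01 p, IsEquivariant Ψ ∧ ∃ c : ℝ, 0 < c ∧
    ∀ g : G, g ≠ 1 → c * (wordLength S g : ℝ) ^ a ≤ ‖Ψ g - Ψ 1‖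

variable {G : Type*} [Group G] [Infinite G] {S : Finset G}

lemma comp_iff {E : Type*} [NormedAddCommGroup E] (hS : IsSymmGen S) {Ψ : G → E}
    (h : IsEquivariant Ψ) {a c : ℝ} (ha : 0 ≤ a) (hc : 0 < c) :
    (∀ t : ℝ, 1 ≤ t → c * t ^ a ≤ compressionFn (S : Set G) Ψ t) ↔
    ∀ g : G, g ≠ 1 → c * (wordLength (S : Set G) g : ℝ) ^ a ≤ ‖Ψ g - Ψ 1‖ := by
  constructor
  · intro H g hg
    have h1 : (1:ℝ) ≤ wordLength (S : Set G) g := by exact_mod_cast wl_pos hS hg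
    refine (H _ h1).trans ?_
    refine csInf_le ⟨0, ?_⟩ ⟨1, g, ?_, ?_⟩
    · rintro r ⟨x, y, -, rfl⟩; exact norm_nonneg _
    · simp [wordDist]
    · rw [norm_sub_rev]
  · intro H t ht
    apply le_csInf
    · obtain ⟨g, hg⟩ := exists_wl_ge hS ⌈t⌉₊
      refine ⟨_, 1, g, ?_, rfl⟩
      have : t ≤ (⌈t⌉₊ : ℝ) := Nat.le_ceil t
      have h2 : ((⌈t⌉₊ : ℕ) : ℝ) ≤ wordLength (S : Set G) g := by exact_mod_cast hg
      simpa [wordDist] using this.trans h2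
    · rintro r ⟨x, y, hxy, rfl⟩
      rw [eqv_dist h]
      have hne : x⁻¹ * y ≠ 1 := by
        intro h0
        rw [wordDist, h0, wl_one] at hxy
        norm_num at hxy; linarith
      refine le_trans ?_ (H _ hne)
      gcongr
      exact hxy

lemma le_one_of_comp {E : Type*} [NormedAddCommGroup E] (hS : IsSymmGen S) {Ψ : G → E}
    (h : IsEquivariant Ψ) {a c : ℝ} (hc : 0 < c)
    (H : ∀ g : G, g ≠ 1 → c * (wordLength (S : Set G) g : ℝ) ^ a ≤ ‖Ψ g - Ψ 1‖) : a ≤ 1 := by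
  obtain ⟨C, hC, hL⟩ := subadd_le hS (fun g => ‖Ψ g - Ψ 1‖) (by simp) (eqv_mul h)
  by_contra! ha
  have h1 : ∀ n : ℕ, 1 ≤ n → c * (n:ℝ) ^ (a - 1) ≤ C := by
    intro n hn
    obtain ⟨g, hg⟩ := exists_wl_eq hS n
    have hne : g ≠ 1 := by rintro rfl; rw [wl_one] at hg; omega
    have h2 := (H g hne).trans (hL g)
    rw [hg] at h2
    have hn' : (0:ℝ) < n := by exact_mod_cast hn
    rw [Real.rpow_sub hn', Real.rpow_one, ← mul_div_assoc, div_le_iff₀ hn']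
    exact h2
  have h2 : Filter.Tendsto (fun n : ℕ => c * (n:ℝ) ^ (a-1)) Filter.atTop Filter.atTop :=
    ((tendsto_rpow_atTop (by linarith)).comp tendsto_natCast_atTop_atTop).const_mul_atTop hc
  obtain ⟨n, hn, hn2⟩ := ((h2.eventually_gt_atTop C).and (Filter.eventually_ge_atTop 1)).exists
  exact absurd (h1 n hn2) (not_le.2 hn)

lemma compExp_nonneg {E : Type*} [NormedAddCommGroup E] (Ψ : G → E) :
    0 ≤ compExp (S : Set G) Ψ := Real.sSup_nonneg (fun _ h => h.1)

lemma compExp_le_one {E : Type*} [NormedAddCommGroup E] (hS : IsSymmGen S) {Ψ : G → E}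
    (h : IsEquivariant Ψ) : compExp (S : Set G) Ψ ≤ 1 := by
  apply Real.sSup_le _ zero_le_one
  rintro a ⟨ha, c, hc, H⟩
  exact le_one_of_comp hS h hc ((comp_iff hS h ha hc).1 H)

variable {p : ℝ}

lemma goodExp_le_one (hp : 1 ≤ p) (hS : IsSymmGen S) {a : ℝ}
    (h : GoodExp G (S : Set G) p a) : a ≤ 1 := by
  have : Fact (1 ≤ ENNReal.ofReal p) := ⟨by simpa using hp⟩
  obtain ⟨ha, Ψ, hΨ, c, hc, H⟩ := h
  exact le_one_of_comp hS hΨ hc H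

lemma alphaSharp_nonneg (hp : 1 ≤ p) : 0 ≤ alphaSharp G (S : Set G) p := by
  have : Fact (1 ≤ ENNReal.ofReal p) := ⟨by simpa using hp⟩
  apply Real.sSup_nonneg
  rintro _ ⟨Ψ, h1, h2, rfl⟩
  exact compExp_nonneg (S := S) Ψ

lemma le_alphaSharp (hp : 1 ≤ p) (hS : IsSymmGen S) {a : ℝ}
    (h : GoodExp G (S : Set G) p a) : a ≤ alphaSharp G (S : Set G) p := by
  have : Fact (1 ≤ ENNReal.ofReal p) := ⟨by simpa using hp⟩
  obtain ⟨ha, Ψ, hΨ, c, hc, H⟩ := h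
  obtain ⟨C, hC, hL⟩ := subadd_le hS (fun g => ‖Ψ g - Ψ 1‖) (by simp) (eqv_mul hΨ)
  have hE := eqv_smul hΨ (r := C⁻¹) (by positivity)
  have hn : ∀ g, ‖C⁻¹ • Ψ g - C⁻¹ • Ψ 1‖ = C⁻¹ * ‖Ψ g - Ψ 1‖ := by
    intro g
    rw [← smul_sub, norm_smul, Real.norm_of_nonneg (by positivity)]
  have h1 : a ≤ compExp (S : Set G) (fun g => C⁻¹ • Ψ g) := by
    apply le_csSup
    · refine ⟨1, ?_⟩
      rintro b ⟨hb, c', hc', H'⟩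
      exact le_one_of_comp hS hE hc' ((comp_iff hS hE hb hc').1 H')
    · refine ⟨ha, C⁻¹ * c, by positivity, (comp_iff hS hE ha (by positivity)).2 ?_⟩
      intro g hg
      have := H g hg
      simp only [hn, mul_assoc]
      gcongr
  refine h1.trans ?_
  apply le_csSup
  · refine ⟨1, ?_⟩
    rintro _ ⟨Φ, -, hΦ, rfl⟩
    exact compExp_le_one hS hΦ
  · refine ⟨_, ?_, hE, rfl⟩
    intro x y
    rw [eqv_dist hE, hn, one_mul, wordDist, inv_mul_le_iff₀ hC]
    exact hL _

lemma exists_good_of_lt (hp : 1 ≤ p) (hS : IsSymmGen S) {a : ℝ} (ha : 0 ≤ a)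
    (h : a < alphaSharp G (S : Set G) p) : ∃ b, a < b ∧ GoodExp G (S : Set G) p b := by
  have : Fact (1 ≤ ENNReal.ofReal p) := ⟨by simpa using hp⟩
  have hne : {a : ℝ | ∃ Ψ : G → Lp01 p,
    LipschitzWord (S : Set G) 1 Ψ ∧ IsEquivariant Ψ ∧ a = compExp (S : Set G) Ψ}.Nonempty := by
    by_contra h0
    rw [Set.not_nonempty_iff_eq_empty] at h0
    rw [alphaSharp, h0, Real.sSup_empty] at h
    linarith
  obtain ⟨_, ⟨Ψ, h1, h2, rfl⟩, h3⟩ := exists_lt_of_lt_csSup hne h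
  have hne' : {α : ℝ | 0 ≤ α ∧ ∃ c : ℝ, 0 < c ∧
    ∀ t : ℝ, 1 ≤ t → c * t ^ α ≤ compressionFn (S : Set G) Ψ t}.Nonempty := by
    by_contra h0
    rw [Set.not_nonempty_iff_eq_empty] at h0
    rw [compExp, h0, Real.sSup_empty] at h3
    linarith
  obtain ⟨b, ⟨hb, c, hc, H⟩, h4⟩ := exists_lt_of_lt_csSup hne' h3
  exact ⟨b, h4, hb, Ψ, h2, c, hc, (comp_iff hS h2 hb hc).1 H⟩

end Good

/-! Negative type of `L_p` -/
section NegType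
open MeasureTheory Set

lemma cos_kernel_integrable {p : ℝ} (hp1 : 1 < p) (hp2 : p < 2) :
    IntegrableOn (fun s : ℝ => (1 - Real.cos s) * s ^ (-1 - p)) (Ioi 0) := by
  have hmeas : ∀ A : Set ℝ, AEStronglyMeasurable
      (fun s : ℝ => (1 - Real.cos s) * s ^ (-1 - p)) (volume.restrict A) := by
    intro A
    have : Measurable (fun s : ℝ => (1 - Real.cos s) * s ^ (-1 - p)) := by fun_prop
    exact this.aestronglyMeasurable
  rw [← Ioc_union_Ioi_eq_Ioi (zero_le_one' ℝ)]
  apply IntegrableOn.union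
  · have h1 : IntegrableOn (fun s : ℝ => s ^ (1 - p)) (Ioc 0 1) := by
      have := (intervalIntegral.intervalIntegrable_rpow' (a := 0) (b := 1) (r := 1 - p)
        (by linarith))
      rwa [intervalIntegrable_iff_integrableOn_Ioc_of_le zero_le_one] at this
    refine Integrable.mono' h1 (hmeas _) ?_
    filter_upwards [ae_restrict_mem measurableSet_Ioc] with s hs
    have h2 : 0 ≤ 1 - Real.cos s := by linarith [Real.cos_le_one s]
    have h3 : 1 - Real.cos s ≤ s ^ 2 := by
      have := Real.one_sub_sq_div_two_le_cos (x := s)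
      nlinarith [sq_nonneg s]
    have hs0 := hs.1
    rw [Real.norm_of_nonneg (by positivity)]
    calc (1 - Real.cos s) * s ^ (-1 - p) ≤ s ^ 2 * s ^ (-1 - p) := by gcongr
      _ = s ^ (1 - p) := by
        rw [← Real.rpow_natCast s 2, ← Real.rpow_add hs0]; norm_num; ring_nf
  · have h1 : IntegrableOn (fun s : ℝ => 2 * s ^ (-1 - p)) (Ioi 1) :=
      (integrableOn_Ioi_rpow_of_lt (by linarith) zero_lt_one).const_mul 2
    refine Integrable.mono' h1 (hmeas _) ?_
    filter_upwards [ae_restrict_mem measurableSet_Ioi] with s hs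
    have h2 : 0 ≤ 1 - Real.cos s := by linarith [Real.cos_le_one s]
    have h3 : 1 - Real.cos s ≤ 2 := by linarith [Real.neg_one_le_cos s]
    have hs0 : (0:ℝ) < s := lt_trans zero_lt_one hs
    rw [Real.norm_of_nonneg (by positivity)]
    gcongr

lemma cos_kernel_pos {p : ℝ} (hp1 : 1 < p) (hp2 : p < 2) :
    0 < ∫ s in Ioi (0:ℝ), (1 - Real.cos s) * s ^ (-1 - p) := by
  have hnn : ∀ s ∈ Ioi (0:ℝ), 0 ≤ (1 - Real.cos s) * s ^ (-1 - p) := by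
    intro s hs
    have hs0 : (0:ℝ) < s := hs
    have h2 : 0 ≤ 1 - Real.cos s := by linarith [Real.cos_le_one s]
    positivity
  rw [setIntegral_pos_iff_support_of_nonneg_ae
    ((ae_restrict_mem measurableSet_Ioi).mono hnn) (cos_kernel_integrable hp1 hp2)]
  have : Ioo (0:ℝ) Real.pi ⊆ Function.support (fun s : ℝ => (1 - Real.cos s) * s ^ (-1 - p))
      ∩ Ioi 0 := by
    intro s hs
    refine ⟨?_, hs.1⟩
    have h1 : Real.cos s < 1 := by
      rw [← Real.cos_zero]
      exact Real.cos_lt_cos_of_nonneg_of_le_pi le_rfl hs.2.le hs.1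
    have h2 : 0 < s ^ (-1 - p) := Real.rpow_pos_of_pos hs.1 _
    have h3 : 0 < 1 - Real.cos s := by linarith
    exact (mul_pos h3 h2).ne'
  refine lt_of_lt_of_le ?_ (measure_mono this)
  simp [Real.pi_pos]

lemma cos_kernel_scale {p : ℝ} (hp1 : 1 < p) (hp2 : p < 2) (x : ℝ) :
    IntegrableOn (fun s : ℝ => (1 - Real.cos (s * x)) * s ^ (-1 - p)) (Ioi 0) ∧
    ∫ s in Ioi (0:ℝ), (1 - Real.cos (s * x)) * s ^ (-1 - p) =
      |x| ^ p * ∫ s in Ioi (0:ℝ), (1 - Real.cos s) * s ^ (-1 - p) := by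
  rcases eq_or_ne x 0 with rfl | hx
  · simp [Real.zero_rpow (by linarith : p ≠ 0)]
  have hy : 0 < |x| := abs_pos.2 hx
  have e : ∀ s ∈ Ioi (0:ℝ), (1 - Real.cos (s * x)) * s ^ (-1 - p) =
      |x| ^ (1 + p) * ((fun s : ℝ => (1 - Real.cos s) * s ^ (-1 - p)) (|x| * s)) := by
    intro s hs
    have hs0 : (0:ℝ) < s := hs
    have h1 : Real.cos (|x| * s) = Real.cos (s * x) := by
      rw [← Real.cos_abs (s * x), abs_mul, abs_of_pos hs0, mul_comm]
    simp only
    rw [h1, Real.mul_rpow hy.le hs0.le]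
    have h2 : |x| ^ (1 + p) * |x| ^ (-1 - p) = 1 := by
      rw [← Real.rpow_add hy]; norm_num
    linear_combination (-(1 - Real.cos (s * x)) * s ^ (-1 - p)) * h2
  constructor
  · rw [integrableOn_congr_fun e measurableSet_Ioi]
    apply Integrable.const_mul
    have := (integrableOn_Ioi_comp_mul_left_iff
      (fun s : ℝ => (1 - Real.cos s) * s ^ (-1 - p)) 0 hy).2
      (by simpa using cos_kernel_integrable hp1 hp2)
    exact this
  · rw [setIntegral_congr_fun measurableSet_Ioi e, integral_const_mul,
      integral_comp_mul_left_Ioi (fun s : ℝ => (1 - Real.cos s) * s ^ (-1 - p)) _ hy, mul_zero, smul_eq_mul, ← mul_assoc]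
    congr 1
    rw [Real.rpow_add hy, Real.rpow_one]
    field_simp

/-- scalar transfer -/
lemma transfer_real {p : ℝ} (hp1 : 1 < p) (hp2 : p ≤ 2) {V : Type*} [Fintype V]
    (W : V → V → ℝ) (hW : ∀ F : V → ℝ, 0 ≤ ∑ u, ∑ v, W u v * (F u - F v) ^ 2) (x : V → ℝ) :
    0 ≤ ∑ u, ∑ v, W u v * |x u - x v| ^ p := by
  rcases hp2.eq_or_lt with rfl | hp2
  · simpa [Real.rpow_two] using hW x
  have hI := cos_kernel_pos hp1 hp2
  refine nonneg_of_mul_nonneg_left ?_ hI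
  rw [Finset.sum_mul]
  simp_rw [Finset.sum_mul, mul_assoc, ← (cos_kernel_scale hp1 hp2 _).2, ← integral_const_mul]
  simp_rw [← integral_finsetSum Finset.univ
    (fun v _ => ((cos_kernel_scale hp1 hp2 (x _ - x v)).1).const_mul (W _ v))]
  rw [← integral_finsetSum Finset.univ (fun u _ => integrable_finsetSum Finset.univ
    (fun v _ => ((cos_kernel_scale hp1 hp2 (x u - x v)).1).const_mul (W u v)))]
  apply setIntegral_nonneg measurableSet_Ioi
  intro s hs
  have hs0 : (0:ℝ) < s := hs
  have h1 := hW (fun u => Real.cos (s * x u))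
  have h2 := hW (fun u => Real.sin (s * x u))
  have h3 : ∑ u, ∑ v, W u v * ((1 - Real.cos (s * (x u - x v))) * s ^ (-1 - p)) =
      (s ^ (-1 - p) / 2) * ((∑ u, ∑ v, W u v * (Real.cos (s * x u) - Real.cos (s * x v)) ^ 2)
        + ∑ u, ∑ v, W u v * (Real.sin (s * x u) - Real.sin (s * x v)) ^ 2) := by
    simp_rw [← Finset.sum_add_distrib, Finset.mul_sum]
    refine Finset.sum_congr rfl fun u _ => Finset.sum_congr rfl fun v _ => ?_
    rw [mul_sub, Real.cos_sub]
    have a1 := Real.sin_sq_add_cos_sq (s * x u)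
    have a2 := Real.sin_sq_add_cos_sq (s * x v)
    linear_combination (-(W u v) * s ^ (-1 - p) / 2) * (a1 + a2)
  rw [h3]
  positivity

lemma lp01_norm_rpow {p : ℝ} (hp : 1 ≤ p) (f : Lp01 p) :
    ‖f‖ ^ p = ∫ z in Icc (0:ℝ) 1, |f z| ^ p := by
  have hp0 : (0:ℝ) < p := by linarith
  have h1 : ENNReal.ofReal p ≠ 0 := by simpa using hp0
  rw [Lp.norm_def, (Lp.memLp f).eLpNorm_eq_integral_rpow_norm h1 ENNReal.ofReal_ne_top,
    ENNReal.toReal_ofReal hp0.le, ENNReal.toReal_ofReal (by positivity),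
    ← Real.rpow_mul (by positivity), inv_mul_cancel₀ hp0.ne', Real.rpow_one]
  rfl

lemma transfer_lp {p : ℝ} (hp1 : 1 < p) (hp2 : p ≤ 2) {V : Type*} [Fintype V]
    (W : V → V → ℝ) (hW : ∀ F : V → ℝ, 0 ≤ ∑ u, ∑ v, W u v * (F u - F v) ^ 2)
    (x : V → Lp01 p) :
    0 ≤ ∑ u, ∑ v, W u v * ‖x u - x v‖ ^ p := by
  have hp0 : (0:ℝ) < p := by linarith
  have h1 : ENNReal.ofReal p ≠ 0 := by simpa using hp0
  have hi : ∀ u v, Integrable (fun z => |x u z - x v z| ^ p)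
      (volume.restrict (Icc (0:ℝ) 1)) := by
    intro u v
    have := ((Lp.memLp (x u)).sub (Lp.memLp (x v))).integrable_norm_rpow h1 ENNReal.ofReal_ne_top
    rw [ENNReal.toReal_ofReal hp0.le] at this
    exact this
  have e : ∀ u v, ‖x u - x v‖ ^ p = ∫ z in Icc (0:ℝ) 1, |x u z - x v z| ^ p := by
    intro u v
    rw [lp01_norm_rpow hp1.le]
    apply integral_congr_ae
    filter_upwards [Lp.coeFn_sub (x u) (x v)] with z hz
    rw [hz]; rfl
  simp_rw [e, ← integral_const_mul]
  simp_rw [← integral_finsetSum Finset.univ (fun v _ => (hi _ v).const_mul (W _ v))]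
  rw [← integral_finsetSum Finset.univ (fun u _ => integrable_finsetSum Finset.univ
    (fun v _ => (hi u v).const_mul (W u v)))]
  exact integral_nonneg fun z => transfer_real hp1 hp2 W hW (fun u => x u z)

/-- transfer in terms of linear functionals -/
lemma transfer_lin {p : ℝ} (hp1 : 1 < p) (hp2 : p ≤ 2) {V : Type*} [Fintype V]
    (Λ : (V → V → ℝ) →ₗ[ℝ] ℝ) (hW : ∀ F : V → ℝ, 0 ≤ Λ (fun u v => (F u - F v) ^ 2))
    (x : V → Lp01 p) :
    0 ≤ Λ (fun u v => ‖x u - x v‖ ^ p) := by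
  classical
  have key : ∀ d : V → V → ℝ, Λ d = ∑ u, ∑ v,
      Λ (fun a b => if a = u ∧ b = v then 1 else 0) * d u v := by
    intro d
    have : d = ∑ u, ∑ v, d u v • (fun a b => if a = u ∧ b = v then (1:ℝ) else 0) := by
      funext a b
      simp [Finset.sum_apply, ite_and]
    conv_lhs => rw [this]
    simp [map_sum, mul_comm]
  rw [key]
  apply transfer_lp hp1 hp2
  intro F
  rw [← key]
  exact hW F
end NegType

/-! One-step multiscale Poincare inequality -/
section OneStep
open Finset
open scoped BigOperators

lemma ex_prod {A B : Type*} [Fintype A] [Fintype B] (f : A × B → ℝ) :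
    𝔼 w, f w = 𝔼 a, 𝔼 b, f (a, b) := by
  rw [← Finset.univ_product_univ, Finset.expect_product]

lemma ex_comm {A B : Type*} [Fintype A] [Fintype B] (f : A → B → ℝ) :
    𝔼 a, 𝔼 b, f a b = 𝔼 b, 𝔼 a, f a b := Finset.expect_comm _ _ _

lemma ex_mono {A : Type*} [Fintype A] {f g : A → ℝ} (h : ∀ a, f a ≤ g a) :
    𝔼 a, f a ≤ 𝔼 a, g a := Finset.expect_le_expect (fun a _ => h a)

lemma ex_var {A : Type*} [Fintype A] [Nonempty A] (f : A → ℝ) (c : ℝ) :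
    𝔼 a, (f a - c) ^ 2 = 𝔼 a, (f a) ^ 2 - 2 * c * 𝔼 a, f a + c ^ 2 := by
  have : ∀ a, (f a - c) ^ 2 = (f a) ^ 2 - 2 * c * f a + c ^ 2 := fun a => by ring
  simp_rw [this, expect_add_distrib, expect_sub_distrib, ← mul_expect]
  rw [Fintype.expect_const]

lemma ex_jensen {A : Type*} [Fintype A] [Nonempty A] (f : A → ℝ) :
    (𝔼 a, f a) ^ 2 ≤ 𝔼 a, (f a) ^ 2 := by
  have h := ex_var f (𝔼 a, f a)
  have h2 : 0 ≤ 𝔼 a, (f a - 𝔼 a, f a) ^ 2 := Finset.expect_nonneg (fun a _ => sq_nonneg _)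
  nlinarith

lemma ex_pair {A : Type*} [Fintype A] [Nonempty A] (f : A → ℝ) :
    𝔼 a, 𝔼 b, (f a - f b) ^ 2 = 2 * 𝔼 a, (f a - 𝔼 a, f a) ^ 2 := by
  have h : ∀ a, 𝔼 b, (f a - f b) ^ 2 = 𝔼 b, (f b) ^ 2 - 2 * f a * 𝔼 b, f b + (f a) ^ 2 := by
    intro a
    rw [← ex_var]
    exact Finset.expect_congr rfl (fun b _ => by ring)
  simp_rw [h, expect_add_distrib, expect_sub_distrib, ← expect_mul, ← mul_expect,
    Fintype.expect_const]
  rw [ex_var]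
  ring

lemma ex_pair_le {A : Type*} [Fintype A] [Nonempty A] (f : A → ℝ) (c : ℝ) :
    𝔼 a, 𝔼 b, (f a - f b) ^ 2 ≤ 2 * 𝔼 a, (f a - c) ^ 2 := by
  rw [ex_pair, ex_var, ex_var f c]
  nlinarith [sq_nonneg (𝔼 a, f a - c)]

lemma ex_bool (f : Bool → ℝ) : 𝔼 b, f b = (f false + f true) / 2 := by
  rw [Fintype.expect_eq_sum_div_card]; simp [add_comm]

variable {A P : Type*} [Fintype A] [Fintype P] [Nonempty A] [Nonempty P]

lemma half_bound (F1 F2 : A → A → P → ℝ) {ε : ℝ} (hε : 0 < ε) (β : A → ℝ)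
    (hβ : ∀ a, β a = 𝔼 b, 𝔼 y, F2 a b y) :
    𝔼 b, (𝔼 a, 𝔼 x, F1 a b x - 𝔼 a, β a) ^ 2 ≤
      (1 + 1 / ε) * (𝔼 b, 𝔼 a, 𝔼 x, 𝔼 y, (F1 a b x - F2 a b y) ^ 2)
        + (1 + ε) * 𝔼 b, 𝔼 a, 𝔼 y, (F2 a b y - β a) ^ 2 := by
  rw [mul_expect, mul_expect, ← expect_add_distrib]
  apply ex_mono
  intro b
  set U := 𝔼 a, 𝔼 x, 𝔼 y, (F1 a b x - F2 a b y) with hU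
  set W := 𝔼 a, 𝔼 y, (F2 a b y - β a) with hW
  have e : 𝔼 a, 𝔼 x, F1 a b x - 𝔼 a, β a = U + W := by
    rw [hU, hW]
    simp_rw [expect_sub_distrib, Fintype.expect_const]
    ring
  have hU2 : U ^ 2 ≤ 𝔼 a, 𝔼 x, 𝔼 y, (F1 a b x - F2 a b y) ^ 2 :=
    (ex_jensen _).trans (ex_mono fun a => (ex_jensen _).trans (ex_mono fun x => ex_jensen _))
  have hW2 : W ^ 2 ≤ 𝔼 a, 𝔼 y, (F2 a b y - β a) ^ 2 :=
    (ex_jensen _).trans (ex_mono fun a => ex_jensen _)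
  rw [e]
  have h1 : (U + W) ^ 2 ≤ (1 + 1 / ε) * U ^ 2 + (1 + ε) * W ^ 2 := by
    have h2 : (1 + 1 / ε) * U ^ 2 + (1 + ε) * W ^ 2 - (U + W) ^ 2 = (U - ε * W) ^ 2 / ε := by
      field_simp; ring
    have h3 : 0 ≤ (U - ε * W) ^ 2 / ε := by positivity
    linarith
  have h4 : 0 ≤ 1 + 1 / ε := by positivity
  have h5 : 0 ≤ 1 + ε := by positivity
  nlinarith

lemma one_step_real (F : (A × A) × (Bool × P) → ℝ) {ε : ℝ} (hε : 0 < ε) :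
    𝔼 u, 𝔼 v, (F u - F v) ^ 2 ≤
      (1 + ε / 2) * ((𝔼 b, 𝔼 u : A × P, 𝔼 v : A × P,
          (F ((u.1, b), (false, u.2)) - F ((v.1, b), (false, v.2))) ^ 2)
        + 𝔼 a, 𝔼 u : A × P, 𝔼 v : A × P,
          (F ((a, u.1), (true, u.2)) - F ((a, v.1), (true, v.2))) ^ 2)
      + 2 * (1 + 1 / ε) * 𝔼 w : A × A, 𝔼 x, 𝔼 y,
          (F (w, (false, x)) - F (w, (true, y))) ^ 2 := by
  set F1 : A → A → P → ℝ := fun a b x => F ((a, b), (false, x)) with hF1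
  set F2 : A → A → P → ℝ := fun a b x => F ((a, b), (true, x)) with hF2
  set α : A → ℝ := fun b => 𝔼 a, 𝔼 x, F1 a b x with hα
  set β : A → ℝ := fun a => 𝔼 b, 𝔼 y, F2 a b y with hβ
  have hb1 := half_bound F1 F2 hε β (fun a => rfl)
  have hb2 := half_bound (fun a b x => F2 b a x) (fun a b x => F1 b a x) hε α (fun a => rfl)
  set c := (𝔼 b, α b + 𝔼 a, β a) / 2 with hc
  have h0 := ex_pair_le F c
  have hV : 𝔼 u, (F u - c) ^ 2 = ((𝔼 b, 𝔼 a, 𝔼 x, (F1 a b x - c) ^ 2)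
      + 𝔼 a, 𝔼 b, 𝔼 x, (F2 a b x - c) ^ 2) / 2 := by
    rw [ex_prod, ex_prod]
    simp_rw [ex_prod (A := Bool), ex_bool, ← expect_div, expect_add_distrib]
    rw [ex_comm (fun a b => 𝔼 x, (F1 a b x - c) ^ 2)]
  have hS1 : ∀ b, 𝔼 u : A × P, 𝔼 v : A × P,
          (F ((u.1, b), (false, u.2)) - F ((v.1, b), (false, v.2))) ^ 2
        = 2 * 𝔼 a, 𝔼 x, (F1 a b x - α b) ^ 2 := by
    intro b
    rw [ex_pair (fun u : A × P => F ((u.1, b), (false, u.2))), ex_prod, ex_prod]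
  have hS2 : ∀ a, 𝔼 u : A × P, 𝔼 v : A × P,
          (F ((a, u.1), (true, u.2)) - F ((a, v.1), (true, v.2))) ^ 2
        = 2 * 𝔼 b, 𝔼 x, (F2 a b x - β a) ^ 2 := by
    intro a
    rw [ex_pair (fun u : A × P => F ((a, u.1), (true, u.2))), ex_prod, ex_prod]
  have hX1 : ∀ b, 𝔼 a, 𝔼 x, (F1 a b x - c) ^ 2
      = 𝔼 a, 𝔼 x, (F1 a b x - α b) ^ 2 + (α b - c) ^ 2 := by
    intro b
    have e1 : ∀ k, 𝔼 a, 𝔼 x, (F1 a b x - k) ^ 2 = 𝔼 w : A × P, (F1 w.1 b w.2 - k) ^ 2 :=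
      fun k => by rw [ex_prod]
    have e2 : α b = 𝔼 w : A × P, F1 w.1 b w.2 := by rw [ex_prod]
    rw [e1, e1, ex_var, ex_var, ← e2]; ring
  have hX2 : ∀ a, 𝔼 b, 𝔼 x, (F2 a b x - c) ^ 2
      = 𝔼 b, 𝔼 x, (F2 a b x - β a) ^ 2 + (β a - c) ^ 2 := by
    intro a
    have e1 : ∀ k, 𝔼 b, 𝔼 x, (F2 a b x - k) ^ 2 = 𝔼 w : A × P, (F2 a w.1 w.2 - k) ^ 2 :=
      fun k => by rw [ex_prod]
    have e2 : β a = 𝔼 w : A × P, F2 a w.1 w.2 := by rw [ex_prod]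
    rw [e1, e1, ex_var, ex_var, ← e2]; ring
  have hJ : 𝔼 w : A × A, 𝔼 x, 𝔼 y, (F (w, (false, x)) - F (w, (true, y))) ^ 2 =
      𝔼 b, 𝔼 a, 𝔼 x, 𝔼 y, (F1 a b x - F2 a b y) ^ 2 := by
    rw [ex_prod, ex_comm]
  have hJ2 : 𝔼 a, 𝔼 b, 𝔼 y, 𝔼 x, (F2 a b y - F1 a b x) ^ 2 =
      𝔼 b, 𝔼 a, 𝔼 x, 𝔼 y, (F1 a b x - F2 a b y) ^ 2 := by
    rw [ex_comm]
    refine Finset.expect_congr rfl fun b _ => Finset.expect_congr rfl fun a _ => ?_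
    rw [ex_comm]
    refine Finset.expect_congr rfl fun b _ => Finset.expect_congr rfl fun a _ => ?_
    ring
  rw [hJ2] at hb2
  rw [hV] at h0
  simp_rw [hX1, hX2, expect_add_distrib] at h0
  simp_rw [hS1, hS2, ← mul_expect]
  rw [hJ]
  rw [ex_var] at hb1 hb2
  rw [ex_var α, ex_var β] at h0
  have hcm1 : 𝔼 b, 𝔼 a, 𝔼 y, (F2 a b y - β a) ^ 2 = 𝔼 a, 𝔼 b, 𝔼 y, (F2 a b y - β a) ^ 2 :=
    ex_comm _
  have hcm2 : 𝔼 a, 𝔼 b, 𝔼 x, (F1 a b x - α b) ^ 2 = 𝔼 b, 𝔼 a, 𝔼 x, (F1 a b x - α b) ^ 2 :=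
    ex_comm _
  rw [hcm1] at hb1
  rw [hcm2] at hb2
  have eα : 𝔼 b, 𝔼 a, 𝔼 x, F1 a b x = 𝔼 b, α b := rfl
  have eβ : 𝔼 b, 𝔼 a, 𝔼 x, F2 b a x = 𝔼 b, β b := rfl
  have eα2 : 𝔼 b, (𝔼 a, 𝔼 x, F1 a b x) ^ 2 = 𝔼 b, (α b) ^ 2 := rfl
  have eβ2 : 𝔼 b, (𝔼 a, 𝔼 x, F2 b a x) ^ 2 = 𝔼 b, (β b) ^ 2 := rfl
  rw [eα, eα2] at hb1
  rw [eβ, eβ2] at hb2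
  generalize 𝔼 b, 𝔼 a, 𝔼 x, 𝔼 y, (F1 a b x - F2 a b y) ^ 2 = J at *
  generalize 𝔼 b, 𝔼 a, 𝔼 x, (F1 a b x - α b) ^ 2 = s1 at *
  generalize 𝔼 a, 𝔼 b, 𝔼 y, (F2 a b y - β a) ^ 2 = s2 at *
  generalize 𝔼 b, α b = mα at *
  generalize 𝔼 b, β b = mβ at *
  generalize 𝔼 b, (α b) ^ 2 = qα at *
  generalize 𝔼 b, (β b) ^ 2 = qβ at *
  rw [hc] at h0
  have := sq_nonneg (mα - mβ)
  nlinarith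

lemma one_step_lp {p : ℝ} (hp1 : 1 < p) (hp2 : p ≤ 2)
    (F : (A × A) × (Bool × P) → Lp01 p) {ε : ℝ} (hε : 0 < ε) :
    𝔼 u, 𝔼 v, ‖F u - F v‖ ^ p ≤
      (1 + ε / 2) * ((𝔼 b, 𝔼 u : A × P, 𝔼 v : A × P,
          ‖F ((u.1, b), (false, u.2)) - F ((v.1, b), (false, v.2))‖ ^ p)
        + 𝔼 a, 𝔼 u : A × P, 𝔼 v : A × P,
          ‖F ((a, u.1), (true, u.2)) - F ((a, v.1), (true, v.2))‖ ^ p)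
      + 2 * (1 + 1 / ε) * 𝔼 w : A × A, 𝔼 x, 𝔼 y,
          ‖F (w, (false, x)) - F (w, (true, y))‖ ^ p := by
  let V := (A × A) × (Bool × P)
  let Λ : (V → V → ℝ) →ₗ[ℝ] ℝ :=
    { toFun := fun d => (1 + ε / 2) * ((𝔼 b, 𝔼 u : A × P, 𝔼 v : A × P,
          d ((u.1, b), (false, u.2)) ((v.1, b), (false, v.2)))
        + 𝔼 a, 𝔼 u : A × P, 𝔼 v : A × P,
          d ((a, u.1), (true, u.2)) ((a, v.1), (true, v.2)))
      + 2 * (1 + 1 / ε) * (𝔼 w : A × A, 𝔼 x, 𝔼 y,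
          d (w, (false, x)) (w, (true, y))) - 𝔼 u, 𝔼 v, d u v
      map_add' := by
        intro d d'
        simp only [Pi.add_apply, expect_add_distrib]
        ring
      map_smul' := by
        intro r d
        simp only [Pi.smul_apply, smul_eq_mul, ← mul_expect, RingHom.id_apply]
        ring }
  have h := transfer_lin hp1 hp2 Λ (fun F => sub_nonneg.2 (one_step_real F hε)) F
  exact sub_nonneg.1 h
end OneStep

/-! Wreath product basics -/
section WB
variable {H : Type} [Group H]

/-- Element of the wreath product from a configuration and a position. -/
def wr (f : lamps H) (x : ℤ) : WreathZ H := ⟨f, Multiplicative.ofAdd x⟩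

/-- Shift of a configuration. -/
def sh (n : ℤ) (f : lamps H) : lamps H := shiftMulEquiv H n f

lemma sh_apply (n : ℤ) (f : lamps H) (y : ℤ) : (sh n f : ℤ → H) y = (f : ℤ → H) (y - n) := rfl

lemma wr_mul (f f' : lamps H) (x x' : ℤ) : wr f x * wr f' x' = wr (f * sh x f') (x + x') := rfl

lemma wr_one : (1 : WreathZ H) = wr 1 0 := rfl

lemma wr_eta (g : WreathZ H) : wr g.left (Multiplicative.toAdd g.right) = g := rfl

lemma wr_left (f : lamps H) (x : ℤ) : (wr f x).left = f := rfl

lemma mul_left_eq (g h : WreathZ H) :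
    (g * h).left = g.left * sh (Multiplicative.toAdd g.right) h.left := rfl

lemma lamps_ext {f g : lamps H} (h : ∀ y, (f : ℤ → H) y = (g : ℤ → H) y) : f = g :=
  Subtype.ext (funext h)

lemma sh_one (n : ℤ) : sh n (1 : lamps H) = 1 := by
  apply lamps_ext; intro y; rfl

/-- Total lamp length. -/
def lampLen (S : Set H) (f : lamps H) : ℝ := ∑ᶠ y : ℤ, (wordLength S ((f : ℤ → H) y) : ℝ)

lemma exists_supp (f : lamps H) : ∃ s : Finset ℤ, ∀ y ∉ s, (f : ℤ → H) y = 1 := by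
  have h : (Function.mulSupport (f : ℤ → H)).Finite := f.2
  refine ⟨h.toFinset, fun y hy => ?_⟩
  simpa using hy

variable {S : Finset H}

lemma lampLen_eq (f : lamps H) (s : Finset ℤ) (hs : ∀ y ∉ s, (f : ℤ → H) y = 1) :
    lampLen (S : Set H) f = ∑ y ∈ s, (wordLength (S : Set H) ((f : ℤ → H) y) : ℝ) := by
  apply finsum_eq_sum_of_support_subset
  intro y hy
  by_contra h
  have h' : y ∉ s := by simpa using h
  rw [Function.mem_support, hs y h', wl_one] at hy
  simp at hy

lemma lampLen_one : lampLen (S : Set H) 1 = 0 := by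
  rw [lampLen_eq 1 ∅ (fun y _ => rfl)]; simp

lemma lampLen_nonneg (f : lamps H) : 0 ≤ lampLen (S : Set H) f :=
  finsum_nonneg (fun _ => Nat.cast_nonneg _)

lemma lampLen_mul (hS : IsSymmGen S) (f g : lamps H) :
    lampLen (S : Set H) (f * g) ≤ lampLen (S : Set H) f + lampLen (S : Set H) g := by
  classical
  obtain ⟨s, hs⟩ := exists_supp f
  obtain ⟨s', hs'⟩ := exists_supp g
  have h1 : ∀ y ∉ s ∪ s', (f : ℤ → H) y = 1 := fun y hy => hs y (by simp at hy; tauto)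
  have h2 : ∀ y ∉ s ∪ s', (g : ℤ → H) y = 1 := fun y hy => hs' y (by simp at hy; tauto)
  have h3 : ∀ y ∉ s ∪ s', ((f * g : lamps H) : ℤ → H) y = 1 := fun y hy => by
    show (f : ℤ → H) y * (g : ℤ → H) y = 1
    rw [h1 y hy, h2 y hy, mul_one]
  rw [lampLen_eq f _ h1, lampLen_eq g _ h2, lampLen_eq (f * g) _ h3, ← Finset.sum_add_distrib]
  apply Finset.sum_le_sum
  intro y _
  exact_mod_cast wl_mul_le hS _ _

lemma lampLen_sh (n : ℤ) (f : lamps H) : lampLen (S : Set H) (sh n f) = lampLen (S : Set H) f := by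
  unfold lampLen
  simp only [sh_apply]
  exact finsum_comp_equiv (Equiv.subRight n) (f := fun y => (wordLength (S : Set H) ((f : ℤ → H) y) : ℝ))

lemma lampLen_inv (hS : IsSymmGen S) (f : lamps H) :
    lampLen (S : Set H) f⁻¹ = lampLen (S : Set H) f := by
  unfold lampLen
  congr 1; ext y
  show (wordLength (S : Set H) (((f : ℤ → H) y)⁻¹) : ℝ) = _
  rw [wl_inv hS]

lemma lampLen_delta (j : ℤ) (h : H) :
    lampLen (S : Set H) (deltaFn j h) = wordLength (S : Set H) h := by
  rw [lampLen_eq _ {j}]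
  · simp [deltaFn]
  · intro y hy
    have : y ≠ j := by simpa using hy
    simp [deltaFn, this]

lemma lampLen_wl (hS : IsSymmGen S) {T : Finset (WreathZ H)} (hT : IsSymmGen T) :
    ∃ C : ℝ, 0 < C ∧ ∀ g : WreathZ H, lampLen (S : Set H) g.left ≤ C * wordLength (T : Set (WreathZ H)) g := by
  apply subadd_le hT (fun g => lampLen (S : Set H) g.left)
  · show lampLen (S : Set H) (1 : lamps H) ≤ 0
    rw [lampLen_one]
  · intro g h
    rw [mul_left_eq]
    refine (lampLen_mul hS _ _).trans ?_
    rw [lampLen_sh]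

lemma wr_delta_inj : Function.Injective (fun h : H => wr (deltaFn 0 h) 0) := by
  intro a b hab
  have := congrArg (fun g : WreathZ H => ((g.left : lamps H) : ℤ → H) 0) hab
  simpa [wr, deltaFn] using this

instance wr_infinite [Infinite H] : Infinite (WreathZ H) :=
  Infinite.of_injective _ (wr_delta_inj (H := H))

/-- The embedding of `H` as the lamp group at position `0`. -/
def wrHom (H : Type) [Group H] : H →* WreathZ H where
  toFun h := wr (deltaFn 0 h) 0
  map_one' := by
    rw [wr_one]; congr 1
    apply lamps_ext; intro y; simp [deltaFn]
  map_mul' a b := by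
    rw [wr_mul]; congr 1
    apply lamps_ext; intro y
    show _ = (deltaFn 0 a : ℤ → H) y * (sh 0 (deltaFn 0 b) : ℤ → H) y
    rw [sh_apply]
    by_cases h : y = 0 <;> simp [deltaFn, h]

lemma good_lamp {p : ℝ} (hS : IsSymmGen S) {T : Finset (WreathZ H)} (hT : IsSymmGen T) {b : ℝ}
    (hg : GoodExp (WreathZ H) (T : Set (WreathZ H)) p b) : GoodExp H (S : Set H) p b := by
  obtain ⟨hb, Ψ, ⟨A, h1, h2, h3, h4⟩, c, hc, hΨ⟩ := hg
  obtain ⟨C, hC, hL⟩ := lampLen_wl hS hT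
  refine ⟨hb, Ψ ∘ wrHom H, ⟨fun h => A (wrHom H h), ?_, ?_, ?_, ?_⟩, c * (C⁻¹) ^ b, by positivity, ?_⟩
  · intro x; beta_reduce; rw [map_one, h1]
  · intro g h x; beta_reduce; rw [map_mul, h2]
  · intro g x y; rw [h3]
  · intro g; simp [← h4]
  · intro g hg
    have hne : wrHom H g ≠ 1 := by
      intro h0
      exact hg (wr_delta_inj (h0.trans (map_one (wrHom H)).symm))
    have := hΨ _ hne
    simp only [Function.comp, map_one]
    refine le_trans ?_ this
    rw [mul_assoc, ← Real.mul_rpow (by positivity) (by positivity)]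
    gcongr
    have h5 := hL (wrHom H g)
    have h6 : lampLen (S : Set H) (wrHom H g).left = wordLength (S : Set H) g := lampLen_delta 0 g
    rw [h6] at h5
    rw [inv_mul_le_iff₀ hC]
    exact h5
end WB

/-! Multiscale upper bound -/
section Stage
open Finset
open scoped BigOperators
variable {H : Type} [Group H]

/-- Multiscale stage predicate. -/
def Stage {p : ℝ} (φ : WreathZ H → Lp01 p) (h : H) (n : ℤ) (D : ℝ) : Prop :=
  ∃ (A P : Type) (_ : Fintype A) (_ : Fintype P) (_ : Nonempty A) (_ : Nonempty P)
    (lam : A → lamps H) (pos : P → ℤ) (comp : A → A),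
    Function.Involutive comp ∧ (∀ a y, (y < 0 ∨ n ≤ y) → (lam a : ℤ → H) y = 1) ∧
    (∀ x, 0 ≤ pos x ∧ pos x < n) ∧
    (∀ a y, 0 ≤ y → y < n → ((lam a : ℤ → H) y)⁻¹ * (lam (comp a) : ℤ → H) y = h ∨
      ((lam a : ℤ → H) y)⁻¹ * (lam (comp a) : ℤ → H) y = h⁻¹) ∧
    𝔼 u : A × P, 𝔼 v : A × P, ‖φ (wr (lam u.1) (pos u.2)) - φ (wr (lam v.1) (pos v.2))‖ ^ p ≤ D

lemma stage_zero {p : ℝ} (hp : 1 ≤ p) {φ : WreathZ H → Lp01 p} (h : H) :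
    Stage φ h 1 (‖φ (wr (deltaFn 0 h) 0) - φ 1‖ ^ p) := by
  have : Fact (1 ≤ ENNReal.ofReal p) := ⟨by simpa using hp⟩
  refine ⟨Bool, Unit, inferInstance, inferInstance, inferInstance, inferInstance,
    fun b => if b then deltaFn 0 h else 1, fun _ => 0, fun b => !b, ?_, ?_, ?_, ?_, ?_⟩
  · intro b; simp
  · intro a y hy
    have : y ≠ 0 := by omega
    cases a
    · rfl
    · simp [deltaFn, this]
  · intro x; simp
  · intro a y h0 h1
    have : y = 0 := by omega
    subst this
    cases a
    · left; simp [deltaFn]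
    · right; simp [deltaFn]
  · have key : ∀ b b' : Bool, ‖φ (wr (if b then deltaFn 0 h else 1) 0) -
        φ (wr (if b' then deltaFn 0 h else 1) 0)‖ ^ p ≤ ‖φ (wr (deltaFn 0 h) 0) - φ 1‖ ^ p := by
      have hnn : 0 ≤ ‖φ (wr (deltaFn 0 h) 0) - φ 1‖ ^ p := by positivity
      have h0 : (0:ℝ) ^ p = 0 := Real.zero_rpow (by linarith)
      intro b b'
      cases b <;> cases b' <;> simp only [Bool.false_eq_true, if_true, if_false, sub_self, norm_zero, h0, ← wr_one, hnn, le_refl]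
      rw [norm_sub_rev]
    refine Finset.expect_le univ_nonempty (fun u _ => ?_)
    exact Finset.expect_le univ_nonempty (fun v _ => key _ _)

lemma shift_norm {p : ℝ} (hp : 1 ≤ p) {φ : WreathZ H → Lp01 p} (hφ : IsEquivariant φ) (k : ℕ) :
    ‖φ (wr 1 k) - φ 1‖ ≤ ‖φ (wr 1 1) - φ 1‖ * k := by
  have : Fact (1 ≤ ENNReal.ofReal p) := ⟨by simpa using hp⟩
  induction k with
  | zero => simp [← wr_one]
  | succ k ih =>
    have h1 := eqv_mul hφ (wr 1 k) (wr 1 1)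
    rw [wr_mul, sh_one, mul_one] at h1
    push_cast
    linarith

lemma stage_succ {p : ℝ} (hp1 : 1 < p) (hp2 : p ≤ 2) {φ : WreathZ H → Lp01 p}
    (hφ : IsEquivariant φ) (h : H) {n : ℤ} (hn : 0 < n) {D ε : ℝ} (hε : 0 < ε)
    (hs : Stage φ h n D) :
    Stage φ h (2 * n) ((2 + ε) * D +
      2 * (1 + 1 / ε) * (‖φ (wr 1 1) - φ 1‖ * (2 * n)) ^ p) := by
  have : Fact (1 ≤ ENNReal.ofReal p) := ⟨by simpa using hp1.le⟩
  obtain ⟨A, P, _, _, _, _, lam, pos, comp, hinv, hsupp, hpos, hcomp, hD⟩ := hs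
  have hmulap : ∀ (f g : lamps H) (y : ℤ), ((f * g : lamps H) : ℤ → H) y = (f : ℤ → H) y * (g : ℤ → H) y :=
    fun _ _ _ => rfl
  refine ⟨A × A, Bool × P, inferInstance, inferInstance, inferInstance, inferInstance,
    fun w => lam w.1 * sh n (lam w.2), fun q => pos q.2 + (if q.1 then n else 0),
    fun w => (comp w.1, comp w.2), ?_, ?_, ?_, ?_, ?_⟩
  · intro w; simp [hinv w.1, hinv w.2]
  · intro a y hy
    rw [hmulap, sh_apply, hsupp _ _ (by omega), hsupp _ _ (by omega), mul_one]
  · rintro ⟨b, x⟩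
    have := hpos x
    cases b <;> simp <;> omega
  · intro a y h0 h1
    simp only [hmulap, sh_apply]
    rcases lt_or_ge y n with h2 | h2
    · rw [hsupp a.2 (y - n) (by omega), hsupp (comp a.2) (y - n) (by omega), mul_one, mul_one]
      exact hcomp _ _ h0 h2
    · rw [hsupp a.1 y (by omega), hsupp (comp a.1) y (by omega), one_mul, one_mul]
      exact hcomp _ _ (by omega) (by omega)
  · refine (one_step_lp hp1 hp2 (fun u : (A × A) × (Bool × P) => φ (wr (lam u.1.1 * sh n (lam u.1.2))
      (pos u.2.2 + (if u.2.1 then n else 0)))) hε).trans ?_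
    have e1 : ∀ (b : A) (u v : A × P),
        ‖φ (wr (lam u.1 * sh n (lam b)) (pos u.2 + (if false = true then n else 0)))
          - φ (wr (lam v.1 * sh n (lam b)) (pos v.2 + (if false = true then n else 0)))‖
        = ‖φ (wr (lam u.1) (pos u.2)) - φ (wr (lam v.1) (pos v.2))‖ := by
      have e : ∀ (b : A) (u : A × P), wr (lam u.1 * sh n (lam b)) (pos u.2 + (if false = true then n else 0))
          = wr (sh n (lam b)) 0 * wr (lam u.1) (pos u.2) := by
        intro b u
        rw [wr_mul]
        congr 1
        · apply lamps_ext; intro y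
          simp only [hmulap, sh_apply, sub_zero]
          rcases lt_or_ge y n with h2 | h2
          · rw [hsupp b (y - n) (by omega)]; simp
          · rw [hsupp u.1 y (by omega)]; simp
        · simp
      intro b u v
      rw [e, e, eqv_left hφ]
    have e2 : ∀ (a : A) (u v : A × P),
        ‖φ (wr (lam a * sh n (lam u.1)) (pos u.2 + (if true = true then n else 0)))
          - φ (wr (lam a * sh n (lam v.1)) (pos v.2 + (if true = true then n else 0)))‖
        = ‖φ (wr (lam u.1) (pos u.2)) - φ (wr (lam v.1) (pos v.2))‖ := by
      have e : ∀ (a : A) (u : A × P), wr (lam a * sh n (lam u.1)) (pos u.2 + (if true = true then n else 0))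
          = wr (lam a) n * wr (lam u.1) (pos u.2) := by
        intro b u
        rw [wr_mul]
        congr 1
        simp [add_comm]
      intro b u v
      rw [e, e, eqv_left hφ]
    have e3 : ∀ (w : A × A) (x y : P),
        ‖φ (wr (lam w.1 * sh n (lam w.2)) (pos x + (if false = true then n else 0)))
          - φ (wr (lam w.1 * sh n (lam w.2)) (pos y + (if true = true then n else 0)))‖ ^ p
        ≤ (‖φ (wr 1 1) - φ 1‖ * (2 * n)) ^ p := by
      intro w x y
      have hx := hpos x
      have hy := hpos y
      obtain ⟨k, hk⟩ := Int.eq_ofNat_of_zero_le (show 0 ≤ pos y + n - pos x by omega)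
      have e : wr (lam w.1 * sh n (lam w.2)) (pos y + (if true = true then n else 0))
          = wr (lam w.1 * sh n (lam w.2)) (pos x + (if false = true then n else 0)) * wr 1 (k : ℤ) := by
        rw [wr_mul, sh_one, mul_one]
        congr 1
        simp only [Bool.false_eq_true, if_true, if_false]
        omega
      have e' := eqv_left hφ (wr (lam w.1 * sh n (lam w.2)) (pos x + (if false = true then n else 0))) 1 (wr 1 (k:ℤ))
      rw [e]
      rw [mul_one] at e'
      rw [e', norm_sub_rev]
      have h3 := shift_norm hp1.le hφ k
      refine Real.rpow_le_rpow (norm_nonneg _) (h3.trans ?_) (by linarith)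
      have : (k : ℝ) ≤ 2 * n := by
        have : (k : ℤ) ≤ 2 * n := by omega
        exact_mod_cast this
      gcongr
    have f1 : (𝔼 b : A, 𝔼 u : A × P, 𝔼 v : A × P,
      ‖φ (wr (lam u.1 * sh n (lam b)) (pos u.2 + (if false = true then n else 0)))
          - φ (wr (lam v.1 * sh n (lam b)) (pos v.2 + (if false = true then n else 0)))‖ ^ p) ≤ D := by
      simp only [e1]
      rw [Finset.expect_const (by simp)]; exact hD
    have f2 : (𝔼 a : A, 𝔼 u : A × P, 𝔼 v : A × P,
      ‖φ (wr (lam a * sh n (lam u.1)) (pos u.2 + (if true = true then n else 0)))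
          - φ (wr (lam a * sh n (lam v.1)) (pos v.2 + (if true = true then n else 0)))‖ ^ p) ≤ D := by
      refine Finset.expect_le univ_nonempty (fun a _ => ?_)
      refine (ex_mono fun u => ex_mono fun v => ?_).trans hD
      exact (congrArg (fun r : ℝ => r ^ p) (e2 a u v)).le
    have f3 : (𝔼 w : A × A, 𝔼 x : P, 𝔼 y : P,
      ‖φ (wr (lam w.1 * sh n (lam w.2)) (pos x + (if false = true then n else 0)))
          - φ (wr (lam w.1 * sh n (lam w.2)) (pos y + (if true = true then n else 0)))‖ ^ p)
        ≤ (‖φ (wr 1 1) - φ 1‖ * (2 * n)) ^ p := by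
      refine Finset.expect_le univ_nonempty (fun w _ => ?_)
      refine Finset.expect_le univ_nonempty (fun x _ => ?_)
      exact Finset.expect_le univ_nonempty (fun y _ => e3 w x y)
    have g1 : (1 + ε / 2) * (D + D) = (2 + ε) * D := by ring
    rw [← g1]
    have h5 : 0 < 2 * (1 + 1 / ε) := by positivity
    refine add_le_add (mul_le_mul_of_nonneg_left (add_le_add f1 f2) (by positivity))
      (mul_le_mul_of_nonneg_left f3 h5.le)

lemma stage_all {p : ℝ} (hp1 : 1 < p) (hp2 : p ≤ 2) {φ : WreathZ H → Lp01 p}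
    (hφ : IsEquivariant φ) {ε : ℝ} (hε : 0 < ε) (hε2 : 2 + ε < 2 ^ p) :
    ∃ E : ℝ, 0 ≤ E ∧ ∀ (h : H) (m : ℕ), Stage φ h (2 ^ m)
      ((2 + ε) ^ m * ‖φ (wr (deltaFn 0 h) 0) - φ 1‖ ^ p + E * ((2:ℝ) ^ m) ^ p) := by
  have : Fact (1 ≤ ENNReal.ofReal p) := ⟨by simpa using hp1.le⟩
  set B := 2 * (1 + 1 / ε) * (‖φ (wr 1 1) - φ 1‖ * 2) ^ p with hB
  have hB0 : 0 ≤ B := by positivity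
  have hd : 0 < (2:ℝ) ^ p - (2 + ε) := by linarith
  refine ⟨B / (2 ^ p - (2 + ε)), by positivity, fun h m => ?_⟩
  set E := B / (2 ^ p - (2 + ε)) with hE
  have hEB : E * 2 ^ p = (2 + ε) * E + B := by
    rw [hE]; field_simp; ring
  have hE0 : 0 ≤ E := by positivity
  induction m with
  | zero =>
    have h0 := stage_zero hp1.le (φ := φ) h
    obtain ⟨A, P, i1, i2, i3, i4, lam, pos, comp, h1, h2, h3, h4, h5⟩ := h0
    refine ⟨A, P, i1, i2, i3, i4, lam, pos, comp, h1, by simpa using h2, by simpa using h3,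
      by simpa using h4, h5.trans ?_⟩
    simp [hE0]
  | succ m ih =>
    have h0 := stage_succ hp1 hp2 hφ h (by positivity) hε ih
    convert h0 using 1
    · ring
    · have e1 : (‖φ (wr 1 1) - φ 1‖ * (2 * ((2 ^ m : ℤ) : ℝ))) ^ p
          = (‖φ (wr 1 1) - φ 1‖ * 2) ^ p * ((2:ℝ) ^ m) ^ p := by
        rw [← Real.mul_rpow (by positivity) (by positivity)]
        push_cast
        ring_nf
      have e2 : ((2:ℝ) ^ (m + 1)) ^ p = ((2:ℝ) ^ m) ^ p * 2 ^ p := by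
        rw [← Real.mul_rpow (by positivity) (by positivity), pow_succ]
      rw [e1, e2]
      linear_combination ((2:ℝ) ^ m) ^ p * hEB + ((2:ℝ) ^ m) ^ p * hB

lemma stage_extract {p : ℝ} (hp1 : 1 < p) {φ : WreathZ H → Lp01 p}
    (hφ : IsEquivariant φ) {S : Finset H} (hS : IsSymmGen S) {h : H} {n : ℕ} {D : ℝ}
    (hs : Stage φ h n D) :
    ∃ g : WreathZ H, lampLen (S : Set H) g.left = n * wordLength (S : Set H) h ∧
      ‖φ g - φ 1‖ ^ p ≤ 2 ^ p * (2 * D) := by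
  have : Fact (1 ≤ ENNReal.ofReal p) := ⟨by simpa using hp1.le⟩
  obtain ⟨A, P, _, _, _, _, lam, pos, comp, hinv, hsupp, hpos, hcomp, hD⟩ := hs
  have h2 : 𝔼 u : A × P, 𝔼 v : A × P,
      ‖φ (wr (lam (comp u.1)) (pos u.2)) - φ (wr (lam v.1) (pos v.2))‖ ^ p ≤ D := by
    refine le_trans (le_of_eq ?_) hD
    apply Fintype.expect_bijective (fun u : A × P => (comp u.1, u.2))
    · exact Function.Involutive.bijective (fun u => by simp [hinv u.1])
    · intro u; rfl
  have h3 : 𝔼 u : A × P, 𝔼 v : A × P,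
      (‖φ (wr (lam u.1) (pos u.2)) - φ (wr (lam v.1) (pos v.2))‖ ^ p +
      ‖φ (wr (lam (comp u.1)) (pos u.2)) - φ (wr (lam v.1) (pos v.2))‖ ^ p) ≤ 2 * D := by
    simp only [Finset.expect_add_distrib]
    linarith
  obtain ⟨u, -, hu⟩ := Finset.exists_le_of_expect_le univ_nonempty h3
  obtain ⟨v, -, hv⟩ := Finset.exists_le_of_expect_le univ_nonempty hu
  have e : (wr (lam u.1) (pos u.2))⁻¹ * wr (lam (comp u.1)) (pos u.2)
      = wr (sh (-pos u.2) ((lam u.1)⁻¹ * lam (comp u.1))) 0 := by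
    rw [inv_mul_eq_iff_eq_mul, wr_mul]
    congr 1
    · have : sh (pos u.2) (sh (-pos u.2) ((lam u.1)⁻¹ * lam (comp u.1)))
        = (lam u.1)⁻¹ * lam (comp u.1) := by
        apply lamps_ext; intro y
        have e0 : y - pos u.2 - -pos u.2 = y := by ring
        rw [sh_apply, sh_apply, e0]
      rw [this, mul_inv_cancel_left]
    · simp
  refine ⟨(wr (lam u.1) (pos u.2))⁻¹ * wr (lam (comp u.1)) (pos u.2), ?_, ?_⟩
  · rw [e, wr_left, lampLen_sh, lampLen_eq _ (Finset.Ico (0:ℤ) n)]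
    · have : ∀ y ∈ Finset.Ico (0:ℤ) n, (wordLength (S : Set H)
          ((((lam u.1)⁻¹ * lam (comp u.1) : lamps H) : ℤ → H) y) : ℝ) = wordLength (S : Set H) h := by
        intro y hy
        rw [Finset.mem_Ico] at hy
        show (wordLength (S : Set H) (((lam u.1 : ℤ → H) y)⁻¹ * (lam (comp u.1) : ℤ → H) y) : ℝ) = _
        rcases hcomp u.1 y hy.1 hy.2 with h | h <;> rw [h]
        rw [wl_inv hS]
      rw [Finset.sum_congr rfl this]
      simp
    · intro y hy
      show ((lam u.1 : ℤ → H) y)⁻¹ * (lam (comp u.1) : ℤ → H) y = 1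
      simp only [Finset.mem_Ico, not_and_or, not_le, not_lt] at hy
      rw [hsupp _ _ hy, hsupp _ _ hy]; simp
  · rw [← eqv_dist hφ]
    set a := ‖φ (wr (lam u.1) (pos u.2)) - φ (wr (lam v.1) (pos v.2))‖
    set b := ‖φ (wr (lam (comp u.1)) (pos u.2)) - φ (wr (lam v.1) (pos v.2))‖
    have ht : ‖φ (wr (lam u.1) (pos u.2)) - φ (wr (lam (comp u.1)) (pos u.2))‖ ≤ a + b := by
      refine (norm_sub_le_norm_sub_add_norm_sub _ (φ (wr (lam v.1) (pos v.2))) _).trans ?_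
      rw [norm_sub_rev (φ (wr (lam v.1) (pos v.2)))]
    have ha : 0 ≤ a := norm_nonneg _
    have hb : 0 ≤ b := norm_nonneg _
    have hm : (max a b) ^ p ≤ a ^ p + b ^ p := by
      have := Real.rpow_nonneg ha p
      have := Real.rpow_nonneg hb p
      rcases max_choice a b with h | h <;> rw [h] <;> linarith
    calc _ ≤ (2 * max a b) ^ p := by
          apply Real.rpow_le_rpow (norm_nonneg _) _ (by linarith)
          have := le_max_left a b
          have := le_max_right a b
          linarith
      _ = 2 ^ p * (max a b) ^ p := Real.mul_rpow (by norm_num) (le_max_of_le_left ha)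
      _ ≤ _ := by gcongr; linarith

end Stage

/-! Upper bound asymptotics -/
section U2

lemma asymp_false {p a b κ δ c₁ C₂ : ℝ} (hp : 1 < p) (hκ : κ = 1 - 1 / p) (ha : 0 < a) (hb : 0 < b)
    (hδ : 0 < δ) (hθ : p + δ < b * p * (1 + κ / a)) (hc : 0 < c₁) (hC : 0 < C₂)
    (hyp : ∀ L₀ : ℝ, ∃ l : ℝ, L₀ ≤ l ∧ 1 ≤ l ∧ ∀ m : ℕ, c₁ * ((2:ℝ) ^ m * l) ^ (b * p) ≤
      C₂ * (((2:ℝ) ^ m) ^ (1 + δ) * l ^ (a * p) + ((2:ℝ) ^ m) ^ p)) : False := by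
  have hκ0 : 0 < κ := by
    rw [hκ]; have : 1 / p < 1 := by rw [div_lt_one (by linarith)]; exact hp
    linarith
  have hκp : κ * p = p - 1 := by rw [hκ]; field_simp
  set θ := b * p * (1 + κ / a) - (p + δ) with hθd
  have hθ0 : 0 < θ := by linarith
  set c₃ := c₁ * ((1 / 2 : ℝ) ^ (κ / a)) ^ (b * p) with hc3
  have hc30 : 0 < c₃ := by positivity
  have ht : Filter.Tendsto (fun N : ℝ => c₃ * N ^ θ) Filter.atTop Filter.atTop :=
    (tendsto_rpow_atTop hθ0).const_mul_atTop hc30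
  obtain ⟨X₀, hX⟩ := Filter.eventually_atTop.1 (ht.eventually_gt_atTop (C₂ * 2))
  obtain ⟨l, hl, hl1, hm⟩ := hyp ((max X₀ 1) ^ (κ / a))
  set x := l ^ (a / κ) with hx
  have hx1 : 1 ≤ x := Real.one_le_rpow hl1 (by positivity)
  have hxl : x ^ (κ / a) = l := by
    rw [hx, ← Real.rpow_mul (by linarith)]
    rw [show a / κ * (κ / a) = 1 by field_simp, Real.rpow_one]
  have hxX : max X₀ 1 ≤ x := by
    have h0 : (0:ℝ) < max X₀ 1 := by positivity
    calc max X₀ 1 = ((max X₀ 1) ^ (κ / a)) ^ (a / κ) := by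
          rw [← Real.rpow_mul h0.le, show κ / a * (a / κ) = 1 by field_simp, Real.rpow_one]
      _ ≤ x := by
          rw [hx]; exact Real.rpow_le_rpow (by positivity) hl (by positivity)
  obtain ⟨n, hn1, hn2⟩ := exists_nat_pow_near hx1 (show (1:ℝ) < 2 by norm_num)
  have h := hm (n + 1)
  set N : ℝ := (2:ℝ) ^ (n + 1) with hN
  have hN1 : 1 ≤ N := by linarith
  have hN0 : 0 < N := by linarith
  have hN2 : N / 2 ≤ x := by rw [hN, pow_succ]; linarith
  have hNX := hX N (by have := le_max_left X₀ 1; linarith)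
  have hlN : (1/2 : ℝ) ^ (κ / a) * N ^ (κ / a) ≤ l := by
    rw [← Real.mul_rpow (by norm_num) hN0.le, ← hxl]
    exact Real.rpow_le_rpow (by positivity) (by linarith) (by positivity)
  have hlN2 : l ^ (a * p) ≤ N ^ (p - 1) := by
    rw [← hxl, ← Real.rpow_mul (by linarith),
      show κ / a * (a * p) = κ * p by field_simp, hκp]
    exact Real.rpow_le_rpow (by linarith) hn2.le (by linarith)
  have lower : c₃ * N ^ (θ + (p + δ)) ≤ c₁ * (N * l) ^ (b * p) := by
    calc c₃ * N ^ (θ + (p + δ)) = c₁ * (N * ((1/2 : ℝ) ^ (κ / a) * N ^ (κ / a))) ^ (b * p) := by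
          rw [Real.mul_rpow hN0.le (by positivity), Real.mul_rpow (by positivity) (by positivity),
            hc3, ← Real.rpow_mul hN0.le]
          rw [show θ + (p + δ) = b * p + κ / a * (b * p) by rw [hθd]; ring, Real.rpow_add hN0]
          ring
      _ ≤ _ := by gcongr
  have upper : C₂ * (N ^ (1 + δ) * l ^ (a * p) + N ^ p) ≤ C₂ * 2 * N ^ (p + δ) := by
    have u1 : N ^ (1 + δ) * l ^ (a * p) ≤ N ^ (p + δ) := by
      calc _ ≤ N ^ (1 + δ) * N ^ (p - 1) := by gcongr
        _ = _ := by rw [← Real.rpow_add hN0]; congr 1; ring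
    have u2 : N ^ p ≤ N ^ (p + δ) := Real.rpow_le_rpow_of_exponent_le hN1 (by linarith)
    calc _ ≤ C₂ * (N ^ (p + δ) + N ^ (p + δ)) := by gcongr
      _ = _ := by ring
  have hfin := lower.trans (h.trans upper)
  rw [Real.rpow_add hN0 θ, ← mul_assoc] at hfin
  have h9 := le_of_mul_le_mul_right hfin (by positivity)
  linarith

variable {H : Type} [Group H] {S : Finset H}

lemma good_lamp' {p : ℝ} (hS : IsSymmGen S) {T : Finset (WreathZ H)} (hT : IsSymmGen T) {b c : ℝ}
    (hb : 0 ≤ b) {Ψ : WreathZ H → Lp01 p} (hE : IsEquivariant Ψ) (hc : 0 < c)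
    (hΨ : ∀ g ≠ 1, c * (wordLength (T : Set (WreathZ H)) g : ℝ) ^ b ≤ ‖Ψ g - Ψ 1‖) :
    IsEquivariant (Ψ ∘ wrHom H) ∧ ∃ c' : ℝ, 0 < c' ∧ ∀ g : WreathZ H, g ≠ 1 →
      c' * lampLen (S : Set H) g.left ^ b ≤ ‖Ψ g - Ψ 1‖ := by
  obtain ⟨A, h1, h2, h3, h4⟩ := hE
  obtain ⟨C, hC, hL⟩ := lampLen_wl hS hT
  refine ⟨⟨fun h => A (wrHom H h), ?_, ?_, ?_, ?_⟩, c * (C⁻¹) ^ b, by positivity, ?_⟩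
  · intro x; beta_reduce; rw [map_one, h1]
  · intro g h x; beta_reduce; rw [map_mul, h2]
  · intro g x y; rw [h3]
  · intro g; simp [← h4]
  · intro g hg
    refine le_trans ?_ (hΨ _ hg)
    rw [mul_assoc, ← Real.mul_rpow (by positivity) (lampLen_nonneg _)]
    have := lampLen_nonneg (S := S) g.left
    gcongr
    rw [inv_mul_le_iff₀ hC]
    exact hL g

lemma upper_two [Infinite H] {p : ℝ} (hp1 : 1 < p) (hp2 : p ≤ 2) (hS : IsSymmGen S)
    {T : Finset (WreathZ H)} (hT : IsSymmGen T) {b : ℝ}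
    (hg : GoodExp (WreathZ H) (T : Set (WreathZ H)) p b) :
    b * (alphaSharp H (S : Set H) p + (1 - 1 / p)) ≤ alphaSharp H (S : Set H) p := by
  have : Fact (1 ≤ ENNReal.ofReal p) := ⟨by simpa using hp1.le⟩
  have hbα := le_alphaSharp hp1.le hS (good_lamp hS hT hg)
  have hb1 : b ≤ 1 := goodExp_le_one hp1.le hT hg
  set α := alphaSharp H (S : Set H) p with hα
  obtain ⟨hb, φ, hφ, c, hc, hΨ⟩ := hg
  by_contra! hcon
  set κ := 1 - 1 / p with hκ
  have hκ0 : 0 < κ := by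
    have : 1 / p < 1 := by rw [div_lt_one (by linarith)]; exact hp1
    rw [hκ]; linarith
  have hb0 : 0 < b := by
    rcases hb.eq_or_lt with h | h
    · rw [← h] at hcon hbα; linarith
    · exact h
  obtain ⟨a, haα, hab⟩ : ∃ a, α < a ∧ a < b * (a + κ) := by
    refine ⟨α + (b * (α + κ) - α) / 2, by linarith, ?_⟩
    nlinarith
  have ha0 : 0 < a := by linarith
  obtain ⟨hψ, c', hc', hlow⟩ := good_lamp' hS hT hb hφ hc hΨ
  -- smallness
  have hnot : ¬ GoodExp H (S : Set H) p a := fun h => by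
    have := le_alphaSharp hp1.le hS h
    linarith
  have hsmall : ∀ d : ℝ, 0 < d → ∃ h : H, h ≠ 1 ∧
      ‖φ (wr (deltaFn 0 h) 0) - φ 1‖ < d * (wordLength (S : Set H) h : ℝ) ^ a := by
    intro d hd
    by_contra! hno
    refine hnot ⟨ha0.le, φ ∘ wrHom H, hψ, d, hd, fun g hg => ?_⟩
    have h7 : (φ ∘ wrHom H) 1 = φ 1 := by simp
    rw [h7]
    exact hno g hg
  have hr : 1 < b * (1 + κ / a) := by
    have : b * (1 + κ / a) = b * (a + κ) / a := by field_simp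
    rw [this, lt_div_iff₀ ha0]; linarith
  set δ := min ((p - 1) / 2) (p * (b * (1 + κ / a) - 1) / 2) with hδ
  have hδ0 : 0 < δ := by
    have : 0 < p * (b * (1 + κ / a) - 1) := mul_pos (by linarith) (by linarith)
    apply lt_min <;> linarith
  have hδ1 : δ ≤ (p - 1) / 2 := min_le_left _ _
  have hδ2 : δ ≤ p * (b * (1 + κ / a) - 1) / 2 := min_le_right _ _
  have hε : 0 < (2:ℝ) ^ (1 + δ) - 2 := by
    have : (2:ℝ) ^ (1:ℝ) < 2 ^ (1 + δ) := Real.rpow_lt_rpow_of_exponent_lt (by norm_num) (by linarith)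
    rw [Real.rpow_one] at this; linarith
  have hε2 : 2 + ((2:ℝ) ^ (1 + δ) - 2) < 2 ^ p := by
    have : (2:ℝ) ^ (1 + δ) < 2 ^ p := Real.rpow_lt_rpow_of_exponent_lt (by norm_num) (by linarith)
    linarith
  obtain ⟨E, hE0, hst⟩ := stage_all hp1 hp2 hφ hε hε2
  refine asymp_false (b := b) (c₁ := c' ^ p) (C₂ := 2 ^ p * (2 * (1 + E))) hp1 hκ ha0 hb0 hδ0
    ?_ (by positivity) (by positivity) ?_
  · have : 0 < p * (b * (1 + κ / a) - 1) := mul_pos (by linarith) (by linarith)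
    nlinarith
  · intro L₀
    set M := max L₀ 1 with hM
    have hM0 : 0 < M := by positivity
    set d := min 1 (c' / M ^ (a - b)) with hd
    have hd0 : 0 < d := lt_min one_pos (by positivity)
    obtain ⟨h, hne, hsm⟩ := hsmall d hd0
    have hl1 : (1:ℝ) ≤ wordLength (S : Set H) h := by exact_mod_cast wl_pos hS hne
    have hwne : wr (deltaFn 0 h) 0 ≠ 1 := by
      intro h0
      exact hne (wr_delta_inj (h0.trans (map_one (wrHom H)).symm))
    have hl := hlow _ hwne
    rw [wr_left, lampLen_delta] at hl
    set l : ℝ := (wordLength (S : Set H) h : ℝ) with hldef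
    have hl0 : 0 < l := by linarith
    refine ⟨l, ?_, hl1, ?_⟩
    · by_contra! hlt
      have hlM : l ≤ M := hlt.le.trans (le_max_left _ _)
      have h1 : c' * l ^ b < d * l ^ a := lt_of_le_of_lt hl hsm
      have h2 : d * l ^ a ≤ c' * l ^ b := by
        calc d * l ^ a ≤ c' / M ^ (a - b) * l ^ a := by gcongr; exact min_le_right _ _
          _ = c' / M ^ (a - b) * (l ^ (a - b) * l ^ b) := by
              rw [← Real.rpow_add hl0]; congr 2; ring
          _ ≤ c' / M ^ (a - b) * (M ^ (a - b) * l ^ b) := by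
              have : 0 ≤ a - b := by linarith
              gcongr
          _ = c' * l ^ b := by field_simp
      linarith
    · intro m
      have hs := hst h m
      rw [show (2 ^ m : ℤ) = ((2 ^ m : ℕ) : ℤ) by push_cast; rfl] at hs
      obtain ⟨g, hg1, hg2⟩ := stage_extract hp1 hφ hS hs
      have hgne : g ≠ 1 := by
        rintro rfl
        have : lampLen (S : Set H) (1 : WreathZ H).left = 0 := lampLen_one
        rw [this] at hg1
        have : (0:ℝ) < ((2 ^ m : ℕ) : ℝ) * l := by positivity
        linarith
      have h3 := hlow g hgne
      rw [hg1] at h3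
      push_cast at h3
      have e0 : 2 + ((2:ℝ) ^ (1 + δ) - 2) = 2 ^ (1 + δ) := by ring
      rw [e0] at hg2
      have e1 : ((2:ℝ) ^ (1 + δ)) ^ m = ((2:ℝ) ^ m) ^ (1 + δ) := by
        rw [← Real.rpow_natCast, ← Real.rpow_natCast, ← Real.rpow_mul (by norm_num),
          ← Real.rpow_mul (by norm_num), mul_comm]
      rw [e1] at hg2
      have hK : ‖φ (wr (deltaFn 0 h) 0) - φ 1‖ ^ p ≤ l ^ (a * p) := by
        rw [Real.rpow_mul hl0.le]
        apply Real.rpow_le_rpow (norm_nonneg _) _ (by linarith)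
        refine hsm.le.trans ?_
        calc d * l ^ a ≤ 1 * l ^ a := by gcongr; exact min_le_left _ _
          _ = _ := one_mul _
      calc c' ^ p * ((2:ℝ) ^ m * l) ^ (b * p) = (c' * ((2:ℝ) ^ m * l) ^ b) ^ p := by
            rw [Real.mul_rpow hc'.le (by positivity), ← Real.rpow_mul (by positivity)]
        _ ≤ ‖φ g - φ 1‖ ^ p := Real.rpow_le_rpow (by positivity) h3 (by linarith)
        _ ≤ _ := hg2
        _ ≤ 2 ^ p * (2 * (((2:ℝ) ^ m) ^ (1 + δ) * l ^ (a * p) + E * ((2:ℝ) ^ m) ^ p)) := by gcongr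
        _ ≤ 2 ^ p * (2 * ((1 + E) * (((2:ℝ) ^ m) ^ (1 + δ) * l ^ (a * p) + ((2:ℝ) ^ m) ^ p))) := by
            have u1 : 0 ≤ ((2:ℝ) ^ m) ^ (1 + δ) * l ^ (a * p) := by positivity
            have u2 : 0 ≤ ((2:ℝ) ^ m) ^ p := by positivity
            gcongr
            nlinarith
        _ = _ := by ring
end U2

/-! Decomposition of `L_p` of the unit interval -/
section Dec
open MeasureTheory Set

/-- Length of the `n`-th piece. -/
def pc (n : ℕ) : ℝ := 1 / (n + 1) - 1 / (n + 2)

/-- Affine map onto the `n`-th piece. -/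
def pe (n : ℕ) (x : ℝ) : ℝ := 1 / (n + 2) + pc n * x

/-- Index of the piece containing `x`. -/
def pn (x : ℝ) : ℕ := ⌊x⁻¹⌋₊ - 1

lemma pc_pos (n : ℕ) : 0 < pc n := by
  unfold pc
  rw [sub_pos]
  apply one_div_lt_one_div_of_lt <;> linarith [(Nat.cast_nonneg n : (0:ℝ) ≤ n)]

lemma pe_image (n : ℕ) : pe n '' Ioc 0 1 = Ioc (1 / (n + 2) : ℝ) (1 / (n + 1)) := by
  have hc := pc_pos n
  ext y
  constructor
  · rintro ⟨x, ⟨h0, h1⟩, rfl⟩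
    unfold pe
    constructor
    · nlinarith
    · have : pc n * x ≤ pc n := by nlinarith
      have h2 : pc n = 1 / (n + 1) - 1 / (n + 2) := rfl
      linarith
  · rintro ⟨h0, h1⟩
    refine ⟨(y - 1 / (n + 2)) / pc n, ⟨div_pos (by linarith) hc, ?_⟩, ?_⟩
    · rw [div_le_one hc]
      have h2 : pc n = 1 / (n + 1) - 1 / (n + 2) := rfl
      linarith
    · unfold pe; field_simp; ring

lemma pe_inj (n : ℕ) : Function.Injective (pe n) := by
  intro x y h
  unfold pe at h
  have hc := pc_pos n
  have : pc n * x = pc n * y := by linarith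
  exact mul_left_cancel₀ hc.ne' this

lemma pn_eq {n : ℕ} {y : ℝ} (hy : y ∈ Ioc (1 / (n + 2) : ℝ) (1 / (n + 1))) : pn y = n := by
  have hn : (0:ℝ) ≤ n := Nat.cast_nonneg n
  have hy0 : 0 < y := lt_trans (by positivity) hy.1
  unfold pn
  have : ⌊y⁻¹⌋₊ = n + 1 := by
    rw [Nat.floor_eq_iff (by positivity)]
    push_cast
    constructor
    · rw [le_inv_comm₀ (by positivity) hy0, ← one_div]; exact hy.2
    · rw [inv_lt_comm₀ hy0 (by positivity)]
      have := hy.1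
      rw [one_div] at this
      have e : (n:ℝ) + 1 + 1 = n + 2 := by ring
      rw [e]
      exact this
  omega

lemma pn_mem {y : ℝ} (hy : y ∈ Ioc (0:ℝ) 1) : y ∈ Ioc (1 / (pn y + 2) : ℝ) (1 / (pn y + 1)) := by
  have hy0 : 0 < y := hy.1
  have h1 : 1 ≤ y⁻¹ := (one_le_inv₀ hy0).2 hy.2
  have h2 : 1 ≤ ⌊y⁻¹⌋₊ := Nat.le_floor (by simpa using h1)
  have h3 : (pn y : ℝ) + 1 = ⌊y⁻¹⌋₊ := by
    have : pn y + 1 = ⌊y⁻¹⌋₊ := by unfold pn; omega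
    exact_mod_cast this
  have h4 := Nat.floor_le (show 0 ≤ y⁻¹ by positivity)
  have h5 := Nat.lt_floor_add_one y⁻¹
  rw [← h3] at h4 h5
  have hp : (0:ℝ) ≤ pn y := Nat.cast_nonneg _
  constructor
  · rw [one_div, inv_lt_comm₀ (by positivity) hy0]; linarith
  · rw [one_div, le_inv_comm₀ hy0 (by positivity)]; exact h4

lemma pn_meas : Measurable pn := by
  unfold pn
  exact (measurable_from_nat (f := fun k : ℕ => k - 1)).comp (Nat.measurable_floor.comp measurable_inv)

lemma pe_meas (n : ℕ) : Measurable (pe n) := by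
  unfold pe; fun_prop

lemma pe_lint (n : ℕ) (f : ℝ → ℝ≥0∞) :
    ∫⁻ x in Ioc (1 / (n + 2) : ℝ) (1 / (n + 1)), f x =
      ∫⁻ x in Icc (0:ℝ) 1, ENNReal.ofReal (pc n) * f (pe n x) := by
  rw [← pe_image, ← restrict_Ioc_eq_restrict_Icc,
    lintegral_image_eq_lintegral_abs_deriv_mul (f' := fun _ => pc n) measurableSet_Ioc]
  · rw [abs_of_pos (pc_pos n)]
  · intro x _
    unfold pe
    have := ((hasDerivAt_id x).const_mul (pc n)).const_add (1 / ((n:ℝ) + 2))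
    simpa using this.hasDerivWithinAt
  · exact (pe_inj n).injOn

lemma pieces_lint (f : ℝ → ℝ≥0∞) :
    ∫⁻ x in Icc (0:ℝ) 1, f x = ∑' n : ℕ, ∫⁻ x in Icc (0:ℝ) 1, ENNReal.ofReal (pc n) * f (pe n x) := by
  have hU : Ioc (0:ℝ) 1 = ⋃ n : ℕ, Ioc (1 / (n + 2) : ℝ) (1 / (n + 1)) := by
    ext y
    rw [mem_iUnion]
    constructor
    · intro hy; exact ⟨pn y, pn_mem hy⟩
    · rintro ⟨n, hn⟩
      have h0 : (0:ℝ) ≤ n := Nat.cast_nonneg n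
      refine ⟨lt_trans (by positivity) hn.1, hn.2.trans ?_⟩
      rw [div_le_one (by positivity)]; linarith
  rw [← restrict_Ioc_eq_restrict_Icc, hU, lintegral_iUnion]
  · simp only [pe_lint]
    rw [restrict_Ioc_eq_restrict_Icc.symm.trans (congrArg _ hU)]
  · intro n; exact measurableSet_Ioc
  · intro m n hmn
    rw [Function.onFun, Set.disjoint_left]
    intro y h1 h2
    exact hmn ((pn_eq h1).symm.trans (pn_eq h2))

lemma pe_qmp (n : ℕ) : Measure.QuasiMeasurePreserving (pe n)
    (volume.restrict (Icc (0:ℝ) 1)) (volume.restrict (Icc (0:ℝ) 1)) := by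
  refine ⟨pe_meas n, Measure.AbsolutelyContinuous.mk fun s hs h0 => ?_⟩
  rw [Measure.map_apply (pe_meas n) hs]
  have h1 := pieces_lint (s.indicator 1)
  rw [lintegral_indicator_one hs, h0, eq_comm, ENNReal.tsum_eq_zero] at h1
  have h2 := h1 n
  rw [lintegral_const_mul' _ _ ENNReal.ofReal_ne_top, mul_eq_zero] at h2
  rcases h2 with h2 | h2
  · have := pc_pos n
    rw [ENNReal.ofReal_eq_zero] at h2; linarith
  · rw [← h2, ← lintegral_indicator_one (pe_meas n hs)]
    rfl

variable {p : ℝ}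

lemma lp01_enorm (hp : 1 ≤ p) (f : Lp01 p) :
    ‖f‖ₑ ^ p = ∫⁻ z in Icc (0:ℝ) 1, ‖f z‖ₑ ^ p := by
  have hp0 : (0:ℝ) < p := by linarith
  have h1 : ENNReal.ofReal p ≠ 0 := by simpa using hp0
  rw [Lp.enorm_def, eLpNorm_eq_lintegral_rpow_enorm_toReal h1 ENNReal.ofReal_ne_top,
    ENNReal.toReal_ofReal hp0.le, ← ENNReal.rpow_mul, one_div, inv_mul_cancel₀ hp0.ne',
    ENNReal.rpow_one]

lemma scale_enorm (hp : 1 ≤ p) (n : ℕ) (r : ℝ) :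
    ‖pc n ^ (1 / p) * r‖ₑ ^ p = ENNReal.ofReal (pc n) * ‖r‖ₑ ^ p := by
  have hp0 : (0:ℝ) < p := by linarith
  have hc := pc_pos n
  rw [enorm_mul, ENNReal.mul_rpow_of_nonneg _ _ hp0.le]
  congr 1
  rw [Real.enorm_eq_ofReal (by positivity), ENNReal.ofReal_rpow_of_nonneg (by positivity) hp0.le,
    ← Real.rpow_mul hc.le, one_div, inv_mul_cancel₀ hp0.ne', Real.rpow_one]

lemma memLp_iff (hp : 1 ≤ p) {f : ℝ → ℝ}
    (hf : AEStronglyMeasurable f (volume.restrict (Icc (0:ℝ) 1)))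
    (h : ∫⁻ z in Icc (0:ℝ) 1, ‖f z‖ₑ ^ p < ∞) :
    MemLp f (ENNReal.ofReal p) (volume.restrict (Icc (0:ℝ) 1)) := by
  have hp0 : (0:ℝ) < p := by linarith
  have h1 : ENNReal.ofReal p ≠ 0 := by simpa using hp0
  refine ⟨hf, ?_⟩
  rw [eLpNorm_lt_top_iff_lintegral_rpow_enorm_lt_top h1 ENNReal.ofReal_ne_top,
    ENNReal.toReal_ofReal hp0.le]
  exact h

lemma piece_memLp (hp : 1 ≤ p) (u : Lp01 p) (n : ℕ) :
    MemLp (fun x => pc n ^ (1 / p) * u (pe n x)) (ENNReal.ofReal p) (volume.restrict (Icc (0:ℝ) 1)) := by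
  apply memLp_iff hp
  · exact (((Lp.stronglyMeasurable u).comp_measurable (pe_meas n)).const_mul _).aestronglyMeasurable
  · simp only [scale_enorm hp]
    have h1 := pieces_lint (fun x => ‖u x‖ₑ ^ p)
    rw [← lp01_enorm hp] at h1
    refine lt_of_le_of_lt ?_ (show ‖u‖ₑ ^ p < ∞ from ENNReal.rpow_lt_top_of_nonneg (by linarith) (by simp))
    rw [h1]
    exact ENNReal.le_tsum n

/-- The decomposition map. -/
def lpD (hp : 1 ≤ p) (u : Lp01 p) (n : ℕ) : Lp01 p := (piece_memLp hp u n).toLp _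

lemma lpD_coe (hp : 1 ≤ p) (u : Lp01 p) (n : ℕ) :
    lpD hp u n =ᵐ[volume.restrict (Icc (0:ℝ) 1)] fun x => pc n ^ (1 / p) * u (pe n x) :=
  MemLp.coeFn_toLp _

lemma lpD_norm (hp : 1 ≤ p) (u : Lp01 p) : ∑' n, ‖lpD hp u n‖ₑ ^ p = ‖u‖ₑ ^ p := by
  rw [lp01_enorm hp, pieces_lint]
  congr 1; ext n
  rw [lp01_enorm hp]
  apply lintegral_congr_ae
  filter_upwards [lpD_coe hp u n] with x hx
  rw [hx, scale_enorm hp]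

lemma lpD_sub (hp : 1 ≤ p) (u v : Lp01 p) (n : ℕ) : lpD hp (u - v) n = lpD hp u n - lpD hp v n := by
  apply Lp.ext
  have h1 := (pe_qmp n).ae_eq_comp (Lp.coeFn_sub u v)
  filter_upwards [lpD_coe hp u n, lpD_coe hp v n, lpD_coe hp (u - v) n, h1,
    Lp.coeFn_sub (lpD hp u n) (lpD hp v n)] with x h2 h3 h4 h5 h6
  rw [h4, h6, Pi.sub_apply, h2, h3, ← mul_sub]
  congr 1

lemma meas_glue (G : ℕ → ℝ → ℝ) (hG : ∀ n, Measurable (G n)) : Measurable (fun y => G (pn y) y) := by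
  have h : Measurable (fun q : ℕ × ℝ => G q.1 q.2) := measurable_from_prod_countable_right hG
  exact h.comp (pn_meas.prodMk measurable_id)

lemma lpD_surj (hp : 1 ≤ p) (F : ℕ → Lp01 p) (hF : ∑' n, ‖F n‖ₑ ^ p < ∞) :
    ∃ u : Lp01 p, lpD hp u = F := by
  have hp0 : (0:ℝ) < p := by linarith
  set G : ℕ → ℝ → ℝ := fun n y => (pc n ^ (1 / p))⁻¹ * F n ((y - 1 / (n + 2)) / pc n) with hG
  obtain ⟨U, hU⟩ : ∃ U : ℝ → ℝ, U = fun y => G (pn y) y := ⟨_, rfl⟩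
  have hmeas : Measurable U := by
    rw [hU]
    apply meas_glue
    intro n
    have h1 : Measurable (F n : ℝ → ℝ) := (Lp.stronglyMeasurable (F n)).measurable
    have h2 : Measurable (fun y : ℝ => (y - 1 / ((n:ℝ) + 2)) / pc n) := by fun_prop
    have h3 : Measurable (fun y : ℝ => (F n : ℝ → ℝ) ((y - 1 / ((n:ℝ) + 2)) / pc n)) := h1.comp h2
    exact h3.const_mul _
  have hval : ∀ n : ℕ, ∀ x ∈ Ioc (0:ℝ) 1, pc n ^ (1 / p) * U (pe n x) = F n x := by
    intro n x hx
    have h1 : pn (pe n x) = n := by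
      apply pn_eq; rw [← pe_image]; exact ⟨x, hx, rfl⟩
    have hc := pc_pos n
    have h0 : U (pe n x) = G n (pe n x) := by rw [hU]; beta_reduce; rw [h1]
    rw [h0, hG]
    beta_reduce
    have h2 : (pe n x - 1 / (n + 2)) / pc n = x := by
      unfold pe; field_simp; ring
    rw [h2, ← mul_assoc, mul_inv_cancel₀ (by positivity), one_mul]
  have hae : ∀ᵐ x ∂(volume.restrict (Icc (0:ℝ) 1)), x ∈ Ioc (0:ℝ) 1 := by
    rw [← restrict_Ioc_eq_restrict_Icc]
    exact ae_restrict_mem measurableSet_Ioc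
  have hlint : ∫⁻ z in Icc (0:ℝ) 1, ‖U z‖ₑ ^ p < ∞ := by
    rw [pieces_lint]
    refine lt_of_le_of_lt (le_of_eq ?_) hF
    congr 1; ext n
    rw [lp01_enorm hp]
    apply lintegral_congr_ae
    filter_upwards [hae] with x hx
    rw [← hval n x hx, scale_enorm hp]
  have hmem := memLp_iff hp hmeas.aestronglyMeasurable hlint
  refine ⟨hmem.toLp U, ?_⟩
  funext n
  apply Lp.ext
  have h1 := (pe_qmp n).ae_eq_comp (hmem.coeFn_toLp)
  filter_upwards [lpD_coe hp (hmem.toLp U) n, h1, hae] with x h2 h3 h4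
  rw [h2, ← hval n x h4]
  congr 1

lemma lp_decomp (hp : 1 ≤ p) (ι : Type*) [Countable ι] [Infinite ι] :
    ∃ D : Lp01 p → ι → Lp01 p, (∀ u, ∑' i, ‖D u i‖ₑ ^ p = ‖u‖ₑ ^ p) ∧
      (∀ u v i, D (u - v) i = D u i - D v i) ∧
      (∀ F : ι → Lp01 p, ∑' i, ‖F i‖ₑ ^ p < ∞ → ∃ u, D u = F) := by
  obtain ⟨_⟩ := nonempty_denumerable ι
  let e : ι ≃ ℕ := Denumerable.eqv ι
  refine ⟨fun u i => lpD hp u (e i), ?_, ?_, ?_⟩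
  · intro u
    rw [← lpD_norm hp u]
    exact e.tsum_eq (fun n => ‖lpD hp u n‖ₑ ^ p)
  · intro u v i; exact lpD_sub hp u v _
  · intro F hF
    obtain ⟨u, hu⟩ := lpD_surj hp (F ∘ e.symm) (by
      rw [← e.symm.tsum_eq] at hF; exact hF)
    refine ⟨u, funext fun i => ?_⟩
    have h1 := congrFun hu (e i)
    simpa using h1

end Dec

/-! Building equivariant maps -/
section Bld
variable {p : ℝ}

lemma enorm_rpow_inj {E : Type*} [NormedAddCommGroup E] (hp : 1 ≤ p) {x y : E}
    (h : ‖x‖ₑ ^ p = ‖y‖ₑ ^ p) : ‖x‖ = ‖y‖ := by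
  have h1 : ‖x‖ₑ = ‖y‖ₑ := (ENNReal.rpow_left_injective (by linarith : p ≠ 0)) h
  rw [← toReal_enorm x, ← toReal_enorm y, h1]

lemma tsum_quasi (hp : 1 ≤ p) {ι E : Type*} [NormedAddCommGroup E] (U V W : ι → E)
    (h1 : ∑' i, ‖U i - V i‖ₑ ^ p < ∞) (h2 : ∑' i, ‖V i - W i‖ₑ ^ p < ∞) :
    ∑' i, ‖U i - W i‖ₑ ^ p < ∞ := by
  have : ∀ i, ‖U i - W i‖ₑ ^ p ≤ 2 ^ (p - 1) * (‖U i - V i‖ₑ ^ p + ‖V i - W i‖ₑ ^ p) := by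
    intro i
    refine le_trans ?_ (ENNReal.rpow_add_le_mul_rpow_add_rpow _ _ hp)
    gcongr
    have := enorm_add_le (U i - V i) (V i - W i)
    rwa [sub_add_sub_cancel] at this
  refine lt_of_le_of_lt (ENNReal.tsum_le_tsum this) ?_
  rw [ENNReal.tsum_mul_left, ENNReal.tsum_add]
  refine ENNReal.mul_lt_top ?_ (ENNReal.add_lt_top.2 ⟨h1, h2⟩)
  exact ENNReal.rpow_lt_top_of_nonneg (by linarith) (by simp)

lemma builder (hp : 1 ≤ p) {G : Type*} [Group G] {ι : Type*} [Countable ι] [Infinite ι]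
    (act : G → (ι → Lp01 p) → (ι → Lp01 p)) (h1 : ∀ F, act 1 F = F)
    (hmul : ∀ g h F, act (g * h) F = act g (act h F))
    (hiso : ∀ g F F', ∑' i, ‖act g F i - act g F' i‖ₑ ^ p = ∑' i, ‖F i - F' i‖ₑ ^ p)
    (F₀ : ι → Lp01 p) (hfin : ∀ g, ∑' i, ‖act g F₀ i - F₀ i‖ₑ ^ p < ∞) :
    ∃ Ψ : G → Lp01 p, IsEquivariant Ψ ∧
      ∀ g, ‖Ψ g - Ψ 1‖ₑ ^ p = ∑' i, ‖act g F₀ i - F₀ i‖ₑ ^ p := by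
  have : Fact (1 ≤ ENNReal.ofReal p) := ⟨by simpa using hp⟩
  have hp0 : 0 < p := by linarith
  obtain ⟨D, hDn, hDs, hDr⟩ := lp_decomp hp ι
  have hex : ∀ g x, ∃ u, D u = fun i => act g (F₀ + D x) i - F₀ i := by
    intro g x
    apply hDr
    apply tsum_quasi hp _ (act g F₀) _ _ (hfin g)
    rw [hiso]
    simp only [Pi.add_apply, add_sub_cancel_left]
    rw [hDn]
    exact ENNReal.rpow_lt_top_of_nonneg (by linarith) (by simp)
  choose A hA using hex
  have hA' : ∀ g x, F₀ + D (A g x) = act g (F₀ + D x) := by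
    intro g x; rw [hA]; funext i; simp
  have hDd : ∀ u v, ‖u - v‖ₑ ^ p = ∑' i, ‖D u i - D v i‖ₑ ^ p := by
    intro u v
    rw [← hDn]; simp only [hDs]
  have hinj : ∀ u v, D u = D v → u = v := by
    intro u v h
    have h2 := hDd u v
    rw [h] at h2
    have h3 : ‖u - v‖ₑ ^ p = 0 := by rw [h2]; simp [hp0]
    rw [ENNReal.rpow_eq_zero_iff_of_pos hp0] at h3
    exact sub_eq_zero.1 (by simpa using h3)
  have hD0 : D 0 = 0 := by
    funext i
    have := hDs 0 0 i
    simpa using this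
  have hA1 : ∀ x, A 1 x = x := by
    intro x
    apply hinj
    have := hA' 1 x
    rw [h1] at this
    exact add_left_cancel this
  have hAd : ∀ g x y, ‖A g x - A g y‖ₑ ^ p = ‖x - y‖ₑ ^ p := by
    intro g x y
    rw [hDd, hA, hA]
    simp only [sub_sub_sub_cancel_right]
    rw [hiso, hDd]
    simp
  refine ⟨fun g => A g 0, ⟨A, hA1, ?_, ?_, ?_⟩, ?_⟩
  · intro g h x
    apply hinj
    apply add_left_cancel (a := F₀)
    rw [hA', hA', hA', hmul]
  · intro g x y
    exact enorm_rpow_inj hp (hAd g x y)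
  · intro g; beta_reduce; rw [hA1]
  · intro g
    beta_reduce
    rw [hA1, sub_zero, ← hDn, hA, hD0, add_zero]

lemma builder2 (hp : 1 ≤ p) {G : Type*} [Group G] {ι : Type*} [Countable ι] [Infinite ι]
    (σ : G → ι → ι) (B : G → ι → Lp01 p → Lp01 p) (hσ1 : ∀ i, σ 1 i = i)
    (hB1 : ∀ i v, B 1 i v = v) (hσ : ∀ g h i, σ (g * h) i = σ h (σ g i))
    (hB : ∀ g h i v, B (g * h) i v = B g i (B h (σ g i) v))
    (hBi : ∀ g i v w, ‖B g i v - B g i w‖ = ‖v - w‖)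
    (F₀ : ι → Lp01 p) (hfin : ∀ g, ∑' i, ‖B g i (F₀ (σ g i)) - F₀ i‖ₑ ^ p < ∞) :
    ∃ Ψ : G → Lp01 p, IsEquivariant Ψ ∧
      ∀ g, ‖Ψ g - Ψ 1‖ₑ ^ p = ∑' i, ‖B g i (F₀ (σ g i)) - F₀ i‖ₑ ^ p := by
  have : Fact (1 ≤ ENNReal.ofReal p) := ⟨by simpa using hp⟩
  refine builder hp (fun g F i => B g i (F (σ g i))) ?_ ?_ ?_ F₀ hfin
  · intro F; funext i; rw [hσ1, hB1]
  · intro g h F; funext i; rw [hB, hσ]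
  · intro g F F'
    have hBe : ∀ g i v w, ‖B g i v - B g i w‖ₑ = ‖v - w‖ₑ := by
      intro g i v w
      rw [← ofReal_norm, ← ofReal_norm, hBi]
    simp only [hBe]
    let e : ι ≃ ι := ⟨σ g, σ g⁻¹, fun i => by rw [← hσ, mul_inv_cancel, hσ1],
      fun i => by rw [← hσ, inv_mul_cancel, hσ1]⟩
    exact e.tsum_eq (fun i => ‖F i - F' i‖ₑ ^ p)

lemma combine (hp : 1 ≤ p) {G : Type*} [Group G] {Ψ₁ Ψ₂ : G → Lp01 p} (h₁ : IsEquivariant Ψ₁)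
    (h₂ : IsEquivariant Ψ₂) :
    ∃ Ψ : G → Lp01 p, IsEquivariant Ψ ∧
      ∀ g, ‖Ψ g - Ψ 1‖ₑ ^ p = ‖Ψ₁ g - Ψ₁ 1‖ₑ ^ p + ‖Ψ₂ g - Ψ₂ 1‖ₑ ^ p := by
  have : Fact (1 ≤ ENNReal.ofReal p) := ⟨by simpa using hp⟩
  have hp0 : 0 < p := by linarith
  obtain ⟨A₁, a1, a2, a3, a4⟩ := h₁
  obtain ⟨A₂, b1, b2, b3, b4⟩ := h₂
  let B : G → ℕ → Lp01 p → Lp01 p := fun g n => match n with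
    | 0 => A₁ g
    | 1 => A₂ g
    | _ => id
  let F₀ : ℕ → Lp01 p := fun n => match n with
    | 0 => Ψ₁ 1
    | 1 => Ψ₂ 1
    | _ => 0
  have hsum : ∀ g, ∑' i, ‖B g i (F₀ i) - F₀ i‖ₑ ^ p
      = ‖Ψ₁ g - Ψ₁ 1‖ₑ ^ p + ‖Ψ₂ g - Ψ₂ 1‖ₑ ^ p := by
    intro g
    rw [tsum_eq_sum (s := Finset.range 2)]
    · rw [Finset.sum_range_succ, Finset.sum_range_one]
      simp only [B, F₀]
      rw [← a4, ← b4]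
    · intro n hn
      match n, hn with
      | 0, hn => simp at hn
      | 1, hn => simp at hn
      | n + 2, _ => simp [B, F₀, hp0]
  obtain ⟨Ψ, hΨ, h⟩ := builder2 hp (fun _ i => i) B (fun _ => rfl) (F₀ := F₀)
    (by rintro (_ | _ | n) v
        · exact a1 v
        · exact b1 v
        · rfl)
    (fun _ _ _ => rfl)
    (by rintro g h (_ | _ | n) v
        · exact a2 g h v
        · exact b2 g h v
        · rfl)
    (by rintro g (_ | _ | n) v w
        · exact a3 g v w
        · exact b3 g v w
        · rfl)
    (by
      intro g
      rw [hsum]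
      exact ENNReal.add_lt_top.2 ⟨ENNReal.rpow_lt_top_of_nonneg (by linarith) (by simp),
        ENNReal.rpow_lt_top_of_nonneg (by linarith) (by simp)⟩)
  exact ⟨Ψ, hΨ, fun g => (h g).trans (hsum g)⟩

lemma zpart {H : Type} [Group H] (hp : 1 ≤ p) {ψ : H → Lp01 p} (hψ : IsEquivariant ψ) :
    ∃ Ψ : WreathZ H → Lp01 p, IsEquivariant Ψ ∧
      ∀ g : WreathZ H, ‖Ψ g - Ψ 1‖ₑ ^ p = ∑' y : ℤ, ‖ψ ((g.left : ℤ → H) y) - ψ 1‖ₑ ^ p := by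
  have : Fact (1 ≤ ENNReal.ofReal p) := ⟨by simpa using hp⟩
  have hp0 : 0 < p := by linarith
  obtain ⟨A, a1, a2, a3, a4⟩ := hψ
  have hfin : ∀ g : WreathZ H, ∑' y : ℤ, ‖ψ ((g.left : ℤ → H) y) - ψ 1‖ₑ ^ p < ∞ := by
    intro g
    obtain ⟨s, hs⟩ := exists_supp g.left
    rw [tsum_eq_sum (s := s)]
    · rw [ENNReal.sum_lt_top]
      intro y _
      exact ENNReal.rpow_lt_top_of_nonneg (by linarith) (by simp)
    · intro y hy
      rw [hs y hy]; simp [hp0]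
  obtain ⟨Ψ, hΨ, h⟩ := builder2 hp (ι := ℤ) (G := WreathZ H)
    (fun g y => y - Multiplicative.toAdd g.right)
    (fun g y => A ((g.left : ℤ → H) y)) (F₀ := fun _ => ψ 1)
    (fun y => sub_zero y) (fun y v => a1 v)
    (fun g h y => by
      show y - (Multiplicative.toAdd g.right + Multiplicative.toAdd h.right) = _
      ring)
    (fun g h y v => by
      rw [mul_left_eq]
      show A ((g.left : ℤ → H) y * (sh (Multiplicative.toAdd g.right) h.left : ℤ → H) y) v = _
      rw [sh_apply, a2])
    (fun g y v w => a3 _ v w)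
    (by intro g; simp only [← a4]; exact hfin g)
  refine ⟨Ψ, hΨ, fun g => (h g).trans ?_⟩
  simp only [← a4]
end Bld

/-! The tree part -/
section Tree
variable {H : Type} [Group H]

lemma wr_inv_one (z : ℤ) : (wr (1 : lamps H) z)⁻¹ = wr 1 (-z) := by
  rw [inv_eq_iff_mul_eq_one, wr_mul, sh_one, wr_one]
  simp

/-- Subgroup of configurations supported on negative positions. -/
def KK (H : Type) [Group H] : Subgroup (WreathZ H) where
  carrier := {g | Multiplicative.toAdd g.right = 0 ∧ ∀ y : ℤ, 0 ≤ y → (g.left : ℤ → H) y = 1}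
  one_mem' := ⟨rfl, fun _ _ => rfl⟩
  mul_mem' := by
    rintro a b ⟨ha, ha'⟩ ⟨hb, hb'⟩
    refine ⟨?_, fun y hy => ?_⟩
    · show Multiplicative.toAdd a.right + Multiplicative.toAdd b.right = 0
      rw [ha, hb, add_zero]
    · rw [mul_left_eq]
      show (a.left : ℤ → H) y * (sh (Multiplicative.toAdd a.right) b.left : ℤ → H) y = 1
      rw [sh_apply, ha, sub_zero, ha' y hy, hb' y hy, mul_one]
  inv_mem' := by
    rintro a ⟨ha, ha'⟩
    have e : a⁻¹ = wr (a.left)⁻¹ 0 := by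
      rw [inv_eq_iff_mul_eq_one, ← wr_eta a, ha, wr_mul, wr_one]
      congr 1
      apply lamps_ext; intro y
      show (a.left : ℤ → H) y * (sh 0 (a.left)⁻¹ : ℤ → H) y = 1
      rw [sh_apply, sub_zero]
      show (a.left : ℤ → H) y * ((a.left : ℤ → H) y)⁻¹ = 1
      simp
    rw [e]
    refine ⟨rfl, fun y hy => ?_⟩
    show ((a.left : ℤ → H) y)⁻¹ = 1
    rw [ha' y hy, inv_one]

/-- The vertex set. -/
abbrev QQ (H : Type) [Group H] := WreathZ H ⧸ KK H

/-- Vertices on the base ray. -/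
def bs (H : Type) [Group H] (z : ℤ) : QQ H := QuotientGroup.mk (wr 1 z)

lemma mk_eq_bs (f : lamps H) (x z : ℤ) :
    (QuotientGroup.mk (wr f x) : QQ H) = bs H z ↔ x = z ∧ ∀ y, z ≤ y → (f : ℤ → H) y = 1 := by
  rw [eq_comm, bs, QuotientGroup.eq, wr_inv_one, wr_mul, one_mul]
  show (-z + x = 0 ∧ ∀ y : ℤ, 0 ≤ y → (sh (-z) f : ℤ → H) y = 1) ↔ _
  simp only [sh_apply, sub_neg_eq_add]
  constructor
  · rintro ⟨h1, h2⟩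
    refine ⟨by linarith, fun y hy => ?_⟩
    have := h2 (y - z) (by linarith)
    rwa [sub_add_cancel] at this
  · rintro ⟨h1, h2⟩
    exact ⟨by linarith, fun y hy => h2 _ (by linarith)⟩

lemma bs_inj : Function.Injective (bs H) := by
  intro a b h
  exact ((mk_eq_bs 1 a b).1 h).1

lemma smul_bs (f : lamps H) (x z : ℤ) :
    wr f x • bs H z = (QuotientGroup.mk (wr f (x + z)) : QQ H) := by
  have : wr f x * wr 1 z = wr f (x + z) := by rw [wr_mul, sh_one, mul_one]
  rw [← this]; rfl

lemma bsn_inj : Function.Injective (fun n : ℕ => bs H n) := by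
  intro a b h
  have := bs_inj h
  exact_mod_cast this

/-- Weight function on vertices. -/
def WW (H : Type) [Group H] (w : ℕ → ℝ) : QQ H → ℝ := Function.extend (fun n : ℕ => bs H n) w 0

lemma WW_bs (w : ℕ → ℝ) (n : ℕ) : WW H w (bs H n) = w n :=
  bsn_inj.extend_apply w 0 n

lemma WW_not (w : ℕ → ℝ) {q : QQ H} (h : ∀ n : ℕ, q ≠ bs H n) : WW H w q = 0 := by
  unfold WW
  rw [Function.extend_apply']
  · rfl
  · rintro ⟨n, hn⟩
    exact h n hn.symm

variable {p : ℝ}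

/-- The displacement sum. -/
def NN (H : Type) [Group H] (p : ℝ) (w : ℕ → ℝ) (g : WreathZ H) : ℝ≥0∞ :=
  ∑' q : QQ H, ‖WW H w (g⁻¹ • q) - WW H w q‖ₑ ^ p

lemma NN_mul (hp : 1 ≤ p) (w : ℕ → ℝ) {g h : WreathZ H} (hg : NN H p w g < ∞) (hh : NN H p w h < ∞) :
    NN H p w (g * h) < ∞ := by
  unfold NN
  refine tsum_quasi hp _ (fun q => WW H w (g⁻¹ • q)) _ ?_ hg
  refine lt_of_le_of_lt (le_of_eq ?_) hh
  unfold NN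
  rw [← (MulAction.toPerm (g⁻¹) : Equiv.Perm (QQ H)).tsum_eq
    (fun q => ‖WW H w (h⁻¹ • q) - WW H w q‖ₑ ^ p)]
  congr 1; ext q
  rw [MulAction.toPerm_apply, mul_inv_rev, mul_smul]

lemma NN_inv (w : ℕ → ℝ) (g : WreathZ H) : NN H p w g⁻¹ = NN H p w g := by
  unfold NN
  rw [← (MulAction.toPerm (g⁻¹) : Equiv.Perm (QQ H)).tsum_eq]
  congr 1; ext q
  rw [MulAction.toPerm_apply, inv_inv, smul_inv_smul, ← enorm_neg, neg_sub]

lemma NN_lamp (hp : 1 ≤ p) (w : ℕ → ℝ) (f : lamps H) : NN H p w (wr f 0) < ∞ := by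
  classical
  have hp0 : 0 < p := by linarith
  obtain ⟨s, hs⟩ := exists_supp f
  obtain ⟨J, hJ⟩ : ∃ J : ℕ, ∀ y ∈ s, y < (J : ℤ) := by
    obtain ⟨b, hb⟩ := s.bddAbove
    refine ⟨(b + 1).toNat, fun y hy => ?_⟩
    have := hb hy
    omega
  have hfix : ∀ n : ℕ, J ≤ n → wr f 0 • bs H n = bs H n := by
    intro n hn
    rw [smul_bs, mk_eq_bs]
    refine ⟨by simp, fun y hy => hs y fun hy' => ?_⟩
    have := hJ y hy'
    omega
  unfold NN
  rw [tsum_eq_sum (s := (Finset.range J).image (fun n : ℕ => bs H n) ∪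
    (Finset.range J).image (fun n : ℕ => wr f 0 • bs H n))]
  · rw [ENNReal.sum_lt_top]
    intro y _
    exact ENNReal.rpow_lt_top_of_nonneg (by linarith) (by simp)
  · intro q hq
    simp only [Finset.mem_union, Finset.mem_image, Finset.mem_range, not_or, not_exists, not_and] at hq
    have key : WW H w ((wr f 0)⁻¹ • q) = WW H w q := by
      by_cases h1 : ∃ n : ℕ, q = bs H n
      · obtain ⟨n, rfl⟩ := h1
        have hn : J ≤ n := by
          by_contra! h; exact hq.1 n h rfl
        have := hfix n hn
        rw [inv_smul_eq_iff.2 this.symm]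
      · by_cases h2 : ∃ n : ℕ, (wr f 0)⁻¹ • q = bs H n
        · obtain ⟨n, hn⟩ := h2
          rw [inv_smul_eq_iff] at hn
          have hn' : J ≤ n := by
            by_contra! h; exact hq.2 n h hn.symm
          rw [hfix n hn'] at hn
          exact absurd ⟨n, hn⟩ h1
        · push Not at h1 h2
          rw [WW_not w h1, WW_not w h2]
    rw [key]; simp [hp0]

lemma NN_shift (hp : 1 ≤ p) (w : ℕ → ℝ) (hw : ∑' n, ‖w n - w (n + 1)‖ₑ ^ p < ∞) :
    NN H p w (wr 1 1) < ∞ := by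
  have hp0 : 0 < p := by linarith
  have hinv : ∀ z : ℤ, (wr 1 1 : WreathZ H)⁻¹ • bs H z = bs H (z - 1) := by
    intro z
    rw [wr_inv_one, smul_bs, mk_eq_bs]
    exact ⟨by ring, fun y _ => rfl⟩
  unfold NN
  rw [← (bsn_inj (H := H)).tsum_eq]
  · rw [tsum_eq_zero_add' ENNReal.summable]
    refine ENNReal.add_lt_top.2 ⟨ENNReal.rpow_lt_top_of_nonneg (by linarith) (by simp), ?_⟩
    refine lt_of_le_of_lt (le_of_eq ?_) hw
    congr 1; ext n
    rw [WW_bs, hinv]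
    have : ((n + 1 : ℕ) : ℤ) - 1 = (n : ℤ) := by push_cast; ring
    rw [this, WW_bs]
  · intro q hq
    by_contra h
    apply hq
    have h1 : ∀ n : ℕ, q ≠ bs H n := fun n hn => h ⟨n, hn.symm⟩
    have h2 : ∀ n : ℕ, (wr 1 1 : WreathZ H)⁻¹ • q ≠ bs H n := by
      intro n hn
      rw [inv_smul_eq_iff, smul_bs] at hn
      apply h1 (n + 1)
      rw [hn, mk_eq_bs]
      exact ⟨by push_cast; ring, fun y _ => rfl⟩
    beta_reduce
    rw [WW_not w h1, WW_not w h2]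
    simp [hp0]

lemma NN_fin (hp : 1 ≤ p) (w : ℕ → ℝ) (hw : ∑' n, ‖w n - w (n + 1)‖ₑ ^ p < ∞) (g : WreathZ H) :
    NN H p w g < ∞ := by
  have hpos : ∀ n : ℕ, NN H p w (wr 1 (n : ℤ)) < ∞ := by
    intro n
    induction n with
    | zero => exact NN_lamp hp w 1
    | succ n ih =>
      have h := NN_mul hp w ih (NN_shift (H := H) hp w hw)
      rw [wr_mul, sh_one, mul_one] at h
      exact_mod_cast h
  have hz : ∀ z : ℤ, NN H p w (wr 1 z) < ∞ := by
    intro z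
    rcases Int.eq_nat_or_neg z with ⟨n, rfl | rfl⟩
    · exact hpos n
    · rw [← wr_inv_one, NN_inv]; exact hpos n
  have h := NN_mul hp w (NN_lamp hp w g.left) (hz (Multiplicative.toAdd g.right))
  rw [wr_mul, sh_one, mul_one, zero_add] at h
  exact h

lemma NN_lower (w : ℕ → ℝ) (g : WreathZ H) (M : ℕ)
    (hM : (M : ℤ) ≤ Multiplicative.toAdd g.right ∨ ∃ y : ℤ, (M : ℤ) ≤ y + 1 ∧ (g.left : ℤ → H) y ≠ 1) :
    ∑ j ∈ Finset.range M, ‖w j‖ₑ ^ p ≤ NN H p w g := by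
  unfold NN
  refine le_trans ?_ (ENNReal.tsum_comp_le_tsum_of_injective (bsn_inj (H := H)) _)
  refine le_trans ?_ (ENNReal.sum_le_tsum (Finset.range M))
  apply Finset.sum_le_sum
  intro j hj
  rw [Finset.mem_range] at hj
  have h0 : WW H w (g⁻¹ • bs H j) = 0 := by
    apply WW_not
    intro n hn
    rw [inv_smul_eq_iff, ← wr_eta g, smul_bs, eq_comm, mk_eq_bs] at hn
    rcases hM with h | ⟨y, hy, hne⟩
    · omega
    · exact hne (hn.2 y (by omega))
  rw [h0, WW_bs, zero_sub, enorm_neg]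

lemma countable_of_gen {G : Type*} [Group G] {T : Finset G} (hT : IsSymmGen T) : Countable G := by
  have : (Set.univ : Set G) = ⋃ n : ℕ, {g : G | wordLength (T : Set G) g ≤ n} := by
    ext g; simp only [Set.mem_univ, Set.mem_iUnion, true_iff]
    exact ⟨wordLength (T : Set G) g, le_refl (wordLength (T : Set G) g)⟩
  rw [← Set.countable_univ_iff, this]
  exact Set.countable_iUnion fun n => (finite_ball hT n).countable

lemma tree_map (hp : 1 ≤ p) [Countable (WreathZ H)] (w : ℕ → ℝ)
    (hw : ∑' n, ‖w n - w (n + 1)‖ₑ ^ p < ∞) :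
    ∃ Ψ : WreathZ H → Lp01 p, IsEquivariant Ψ ∧
      ∀ g : WreathZ H, ‖Ψ g - Ψ 1‖ₑ ^ p = NN H p w g := by
  have : Fact (1 ≤ ENNReal.ofReal p) := ⟨by simpa using hp⟩
  have : Infinite (QQ H) := Infinite.of_injective _ (bs_inj (H := H))
  have : Countable (QQ H) := Quotient.countable
  obtain ⟨e, he⟩ : ∃ e : Lp01 p, ‖e‖ₑ = 1 := by
    refine ⟨MeasureTheory.Lp.const _ _ 1, ?_⟩
    rw [← ofReal_norm, MeasureTheory.Lp.norm_const']
    · simp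
    · simp; linarith
    · exact ENNReal.ofReal_ne_top
  have hes : ∀ r s : ℝ, ‖r • e - s • e‖ₑ = ‖r - s‖ₑ := by
    intro r s; rw [← sub_smul, enorm_smul, he, mul_one]
  obtain ⟨Ψ, hΨ, h⟩ := builder2 hp (ι := QQ H) (G := WreathZ H)
    (fun g q => g⁻¹ • q) (fun _ _ v => v) (fun q => by simp) (fun _ _ => rfl)
    (fun g h q => by rw [mul_inv_rev, mul_smul]) (fun _ _ _ _ => rfl) (fun _ _ _ _ => rfl)
    (fun q => WW H w q • e) (fun g => by simp only [hes]; exact NN_fin hp w hw g)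
  refine ⟨Ψ, hΨ, fun g => (h g).trans ?_⟩
  simp only [hes]; rfl

/-- The reflection of the wreath product. -/
def flipHom (H : Type) [Group H] : WreathZ H →* WreathZ H where
  toFun g := wr ⟨fun y => (g.left : ℤ → H) (-y), by
    apply Set.Finite.subset (Set.Finite.image (fun y => -y) g.left.2)
    intro x hx
    exact ⟨-x, hx, by simp⟩⟩ (-Multiplicative.toAdd g.right)
  map_one' := by
    rw [wr_one]; congr 1
  map_mul' a b := by
    rw [wr_mul]
    congr 1
    · apply lamps_ext; intro y
      show (a.left : ℤ → H) (-y) * (b.left : ℤ → H) (-y - Multiplicative.toAdd a.right)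
        = (a.left : ℤ → H) (-y) * (b.left : ℤ → H) (-(y - -Multiplicative.toAdd a.right))
      have e : ∀ u v : ℤ, -u - v = -(u - -v) := fun u v => by ring
      rw [e]
    · exact neg_add _ _

lemma eqv_comp_hom {G K : Type*} [Group G] [Group K] {E : Type*} [AddGroup E] [Norm E] {Ψ : K → E}
    (h : IsEquivariant Ψ) (θ : G →* K) : IsEquivariant (fun g => Ψ (θ g)) := by
  obtain ⟨A, h1, h2, h3, h4⟩ := h
  refine ⟨fun g => A (θ g), ?_, ?_, ?_, ?_⟩
  · intro x; beta_reduce; rw [map_one, h1]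
  · intro g h x; beta_reduce; rw [map_mul, h2]
  · intro g x y; rw [h3]
  · intro g; simp [← h4]

lemma two_sided (hp : 1 ≤ p) [Countable (WreathZ H)] (w : ℕ → ℝ)
    (hw : ∑' n, ‖w n - w (n + 1)‖ₑ ^ p < ∞) :
    ∃ Ψ : WreathZ H → Lp01 p, IsEquivariant Ψ ∧
      ∀ (g : WreathZ H) (M : ℕ), ((M : ℤ) ≤ |Multiplicative.toAdd g.right| ∨
          ∃ y : ℤ, (M : ℤ) ≤ |y| + 1 ∧ (g.left : ℤ → H) y ≠ 1) →
        ∑ j ∈ Finset.range M, ‖w j‖ₑ ^ p ≤ ‖Ψ g - Ψ 1‖ₑ ^ p := by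
  obtain ⟨Ψ₁, h1, e1⟩ := tree_map (H := H) hp w hw
  obtain ⟨Ψ, h, e⟩ := combine hp h1 (eqv_comp_hom h1 (flipHom H))
  refine ⟨Ψ, h, fun g M hM => ?_⟩
  rw [e, map_one, e1, e1]
  have hor : ((M : ℤ) ≤ Multiplicative.toAdd g.right ∨
      ∃ y : ℤ, (M : ℤ) ≤ y + 1 ∧ (g.left : ℤ → H) y ≠ 1) ∨
      ((M : ℤ) ≤ -Multiplicative.toAdd g.right ∨
      ∃ y : ℤ, (M : ℤ) ≤ y + 1 ∧ (g.left : ℤ → H) (-y) ≠ 1) := by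
    rcases hM with h | ⟨y, hy, hne⟩
    · rcases le_abs.1 h with h | h
      · exact Or.inl (Or.inl h)
      · exact Or.inr (Or.inl h)
    · rcases abs_choice y with h | h
      · exact Or.inl (Or.inr ⟨y, by rw [h] at hy; exact hy, hne⟩)
      · exact Or.inr (Or.inr ⟨-y, by rw [h] at hy; exact hy, by rwa [neg_neg]⟩)
  rcases hor with h | h
  · exact (NN_lower w g M h).trans le_self_add
  · exact (NN_lower w (flipHom H g) M h).trans le_add_self
end Tree

/-! The lower bound -/
section Lower

lemma sum_lower {r : ℝ} (hr : 0 ≤ r) (M : ℕ) :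
    (M : ℝ) ^ (r + 1) / (r + 1) ≤ ∑ j ∈ Finset.range M, ((j : ℝ) + 1) ^ r := by
  have hr1 : 0 < r + 1 := by linarith
  induction M with
  | zero => simp [Real.zero_rpow hr1.ne']
  | succ M ih =>
    rw [Finset.sum_range_succ]
    set u : ℝ := (M : ℝ) + 1 with hu
    have hu0 : 0 < u := by positivity
    have hb : 1 + (r + 1) * (-(1 / u)) ≤ (1 + -(1 / u)) ^ (r + 1) := by
      apply one_add_mul_self_le_rpow_one_add _ (by linarith)
      have : 1 / u ≤ 1 := by rw [div_le_one hu0]; simp [hu]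
      linarith
    have e1 : (1 + -(1 / u)) = (M : ℝ) / u := by field_simp; rw [hu]; ring
    rw [e1, Real.div_rpow (by positivity) hu0.le, le_div_iff₀ (by positivity),
      Real.rpow_add_one hu0.ne'] at hb
    have e2 : (1 + (r + 1) * -(1 / u)) * (u ^ r * u) = u ^ r * u - (r + 1) * u ^ r := by
      field_simp
      ring
    rw [e2] at hb
    have : ((M + 1 : ℕ) : ℝ) = u := by simp [hu]
    rw [this, Real.rpow_add_one hu0.ne', div_le_iff₀ hr1]
    rw [div_le_iff₀ hr1] at ih
    nlinarith

lemma weight_diff {γ : ℝ} (h0 : 0 ≤ γ) (h1 : γ ≤ 1) (n : ℕ) :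
    |((n : ℝ) + 1) ^ γ - ((n : ℝ) + 1 + 1) ^ γ| ≤ ((n : ℝ) + 1) ^ (γ - 1) := by
  set u : ℝ := (n : ℝ) + 1 with hu
  have hu0 : 0 < u := by positivity
  have hb : (1 + 1 / u) ^ γ ≤ 1 + γ * (1 / u) :=
    rpow_one_add_le_one_add_mul_self (by have : 0 < 1 / u := by positivity
                                         linarith) h0 h1
  have e1 : 1 + 1 / u = (u + 1) / u := by field_simp
  rw [e1, Real.div_rpow (by positivity) hu0.le, div_le_iff₀ (by positivity)] at hb
  have e2 : (1 + γ * (1 / u)) * u ^ γ = u ^ γ + γ * u ^ (γ - 1) := by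
    rw [Real.rpow_sub_one hu0.ne']; field_simp
  rw [e2] at hb
  have hm : u ^ γ ≤ (u + 1) ^ γ := Real.rpow_le_rpow hu0.le (by linarith) h0
  have hp : 0 ≤ u ^ (γ - 1) := by positivity
  rw [abs_sub_comm, abs_of_nonneg (by linarith)]
  nlinarith

lemma weight_sum {p γ : ℝ} (hp : 1 ≤ p) (h0 : 0 ≤ γ) (h1 : γ ≤ 1) (h : γ = 0 ∨ 1 < (1 - γ) * p) :
    ∑' n : ℕ, ‖((n : ℝ) + 1) ^ γ - (((n + 1 : ℕ) : ℝ) + 1) ^ γ‖ₑ ^ p < ∞ := by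
  rcases h with rfl | h
  · have : 0 < p := by linarith
    simp [this]
  · have hs : Summable fun n : ℕ => ((n + 1 : ℕ) : ℝ) ^ (-((1 - γ) * p)) := by
      rw [summable_nat_add_iff 1 (f := fun n : ℕ => (n : ℝ) ^ (-((1 - γ) * p)))]
      exact Real.summable_nat_rpow.2 (by linarith)
    refine lt_of_le_of_lt (ENNReal.tsum_le_tsum fun n => ?_) hs.tsum_ofReal_lt_top
    rw [Real.enorm_eq_ofReal_abs, ENNReal.ofReal_rpow_of_nonneg (abs_nonneg _) (by linarith)]
    apply ENNReal.ofReal_le_ofReal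
    push_cast
    have := Real.rpow_le_rpow (abs_nonneg _) (weight_diff h0 h1 n) (by linarith : 0 ≤ p)
    rw [← Real.rpow_mul (by positivity)] at this
    refine this.trans (le_of_eq ?_)
    congr 1; ring

lemma sum_rpow_ge {ι : Type*} (s : Finset ι) (n : ι → ℝ) (hn : ∀ i, 0 ≤ n i) {q : ℝ} (hq : 0 < q)
    (hq1 : q ≤ 1) : (∑ i ∈ s, n i) ^ q ≤ ∑ i ∈ s, n i ^ q := by
  classical
  induction s using Finset.induction_on with
  | empty => simp [Real.zero_rpow hq.ne']
  | insert i s hi ih =>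
    rw [Finset.sum_insert hi, Finset.sum_insert hi]
    have := Real.rpow_add_le_add_rpow (hn i) (Finset.sum_nonneg fun j _ => hn j : 0 ≤ ∑ j ∈ s, n j)
      hq.le hq1
    linarith

lemma key_ineq {ι : Type*} {p a β σ : ℝ} (hp : 1 ≤ p) (hβ : 0 < β) (hβa : β < a)
    (hσ : β * p ≤ σ) (hσ2 : β * (a * p - 1) ≤ σ * (a - β)) :
    ∃ C : ℝ, 0 < C ∧ ∀ (s : Finset ι) (n : ι → ℝ) (M : ℝ), (∀ i, 0 ≤ n i) → 1 ≤ M →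
      (s.card : ℝ) ≤ 2 * M →
      (M + ∑ i ∈ s, n i) ^ (β * p) ≤ C * (∑ i ∈ s, n i ^ (a * p) + M ^ σ) := by
  have hβp : 0 < β * p := by positivity
  have ha : 0 < a := by linarith
  have hap : 0 < a * p := by positivity
  have hσ0 : 0 < σ := by linarith
  refine ⟨2 ^ (β * p) * 2 ^ (a * p), by positivity, fun s n M hn hM hc => ?_⟩
  set X := ∑ i ∈ s, n i with hX
  set A := ∑ i ∈ s, n i ^ (a * p) with hA
  have hA0 : 0 ≤ A := Finset.sum_nonneg fun i _ => Real.rpow_nonneg (hn i) _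
  have hX0 : 0 ≤ X := Finset.sum_nonneg fun i _ => hn i
  have hMs : 0 ≤ M ^ σ := by positivity
  have h2 : (1 : ℝ) ≤ 2 ^ (a * p) := Real.one_le_rpow (by norm_num) hap.le
  have hsuff : ∀ Y : ℝ, 0 ≤ Y → M + X ≤ 2 * Y → Y ^ (β * p) ≤ 2 ^ (a * p) * (A + M ^ σ) →
      (M + X) ^ (β * p) ≤ 2 ^ (β * p) * 2 ^ (a * p) * (A + M ^ σ) := by
    intro Y hY h1 h3
    calc (M + X) ^ (β * p) ≤ (2 * Y) ^ (β * p) :=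
          Real.rpow_le_rpow (by linarith) h1 hβp.le
      _ = 2 ^ (β * p) * Y ^ (β * p) := Real.mul_rpow (by norm_num) hY
      _ ≤ 2 ^ (β * p) * (2 ^ (a * p) * (A + M ^ σ)) := by gcongr
      _ = _ := by ring
  rcases le_total X M with hXM | hXM
  · refine hsuff M (by linarith) (by linarith) ?_
    have : M ^ (β * p) ≤ M ^ σ := Real.rpow_le_rpow_of_exponent_le hM hσ
    nlinarith
  · refine hsuff X hX0 (by linarith) ?_
    have hX1 : 1 ≤ X := by linarith
    rcases le_total (a * p) 1 with h1 | h1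
    · have e1 : X ^ (β * p) ≤ X ^ (a * p) :=
        Real.rpow_le_rpow_of_exponent_le hX1 (by nlinarith)
      have e2 := sum_rpow_ge s n hn hap h1
      nlinarith
    · rcases le_or_gt (X ^ (β * p)) (M ^ σ) with h3 | h3
      · nlinarith
      have hMX : M ≤ X ^ (β * p / σ) := by
        have := Real.rpow_le_rpow hMs h3.le (by positivity : 0 ≤ 1 / σ)
        rw [← Real.rpow_mul (by linarith), ← Real.rpow_mul (by linarith), mul_one_div_cancel hσ0.ne',
          Real.rpow_one] at this
        refine this.trans (le_of_eq ?_)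
        congr 1; ring
      have hpm : X ^ (a * p) ≤ (2 * M) ^ (a * p - 1) * A := by
        have := Real.rpow_sum_le_const_mul_sum_rpow s n h1
        simp only [abs_of_nonneg (hn _)] at this
        refine this.trans ?_
        gcongr
      have e3 : (2 * M) ^ (a * p - 1) ≤ 2 ^ (a * p) * X ^ (β * p / σ * (a * p - 1)) := by
        rw [Real.mul_rpow (by norm_num) (by linarith), Real.rpow_mul hX0]
        refine mul_le_mul ?_ ?_ (by positivity) (by positivity)
        · exact Real.rpow_le_rpow_of_exponent_le (by norm_num) (by linarith)
        · exact Real.rpow_le_rpow (by linarith) hMX (by linarith)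
      have e4 : X ^ (β * p) * X ^ (β * p / σ * (a * p - 1)) ≤ X ^ (a * p) := by
        rw [← Real.rpow_add (by linarith)]
        apply Real.rpow_le_rpow_of_exponent_le hX1
        have : β * p / σ * (a * p - 1) ≤ p * (a - β) := by
          rw [div_mul_eq_mul_div, div_le_iff₀ hσ0]
          nlinarith
        linarith
      have e5 : X ^ (β * p) * X ^ (β * p / σ * (a * p - 1)) ≤
          (2 ^ (a * p) * A) * X ^ (β * p / σ * (a * p - 1)) := by
        calc _ ≤ _ := e4
          _ ≤ _ := hpm
          _ ≤ (2 ^ (a * p) * X ^ (β * p / σ * (a * p - 1))) * A := by gcongr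
          _ = _ := by ring
      have e6 := le_of_mul_le_mul_right e5 (by positivity)
      nlinarith
end Lower

section Lower2
variable {H : Type} [Group H]

/-- The walk writing the values `h 0, …, h (n-1)`. -/
def walk (h : ℕ → H) : ℕ → WreathZ H
  | 0 => 1
  | n + 1 => walk h n * (wrHom H (h n) * wr 1 1)

lemma walk_right (h : ℕ → H) (n : ℕ) : Multiplicative.toAdd (walk h n).right = (n : ℤ) := by
  induction n with
  | zero => rfl
  | succ n ih =>
    show Multiplicative.toAdd (walk h n).right + (0 + 1) = _
    rw [ih]; push_cast; ring

lemma walk_left (h : ℕ → H) (n : ℕ) (y : ℤ) :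
    ((walk h n).left : ℤ → H) y = if 0 ≤ y ∧ y < n then h y.toNat else 1 := by
  induction n with
  | zero =>
    rw [if_neg (by push_cast; omega)]; rfl
  | succ n ih =>
    have e : ((walk h (n + 1)).left : ℤ → H) y = ((walk h n).left : ℤ → H) y *
        ((if y - Multiplicative.toAdd (walk h n).right = 0 then h n else 1) * 1) := rfl
    rw [e, ih, walk_right, mul_one]
    by_cases h1 : y = n
    · subst h1
      rw [if_neg (by omega), if_pos (by omega), if_pos (by push_cast; omega)]
      simp
    · rw [if_neg (c := y - (n : ℤ) = 0) (by omega), mul_one]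
      congr 1
      push_cast
      apply propext
      omega

lemma wl_bound {S : Finset H} {T : Finset (WreathZ H)} (hS : IsSymmGen S) (hT : IsSymmGen T) :
    ∃ C : ℝ, 0 < C ∧ ∀ (g : WreathZ H) (M : ℕ), |Multiplicative.toAdd g.right| ≤ (M : ℤ) →
      (∀ y : ℤ, (g.left : ℤ → H) y ≠ 1 → |y| + 1 ≤ (M : ℤ)) →
      (wordLength (T : Set (WreathZ H)) g : ℝ) ≤ C * (M + ∑ j ∈ Finset.range (2 * M),
        (wordLength (S : Set H) ((g.left : ℤ → H) ((j : ℤ) - M)) : ℝ)) := by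
  obtain ⟨C, hC, hCl⟩ := subadd_le hS
    (fun h => (wordLength (T : Set (WreathZ H)) (wrHom H h) : ℝ))
    (by rw [map_one, wl_one]; simp)
    (fun g h => by rw [map_mul]; exact_mod_cast wl_mul_le hT _ _)
  set τ : ℝ := (wordLength (T : Set (WreathZ H)) (wr 1 1) : ℝ) with hτ
  have hτ0 : 0 ≤ τ := by positivity
  have hpow : ∀ n : ℕ, (wordLength (T : Set (WreathZ H)) (wr 1 (n : ℤ)) : ℝ) ≤ n * τ := by
    intro n
    induction n with
    | zero =>
      have : (wr 1 ((0 : ℕ) : ℤ) : WreathZ H) = 1 := rfl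
      rw [this, wl_one]; simp
    | succ n ih =>
      have e : (wr 1 ((n + 1 : ℕ) : ℤ) : WreathZ H) = wr 1 (n : ℤ) * wr 1 1 := by
        rw [wr_mul, sh_one, mul_one]; push_cast; rfl
      rw [e]
      have := wl_mul_le hT (wr 1 (n : ℤ)) (wr 1 1 : WreathZ H)
      have h2 : (wordLength (T : Set (WreathZ H)) (wr 1 (n : ℤ) * wr 1 1) : ℝ) ≤
        wordLength (T : Set (WreathZ H)) (wr 1 (n : ℤ)) + τ := by
        rw [hτ]; exact_mod_cast this
      push_cast
      linarith
  have hneg : ∀ n : ℕ, (wordLength (T : Set (WreathZ H)) (wr 1 (-(n : ℤ))) : ℝ) ≤ n * τ := by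
    intro n
    rw [← wr_inv_one, wl_inv hT]; exact hpow n
  have hwalk : ∀ (h : ℕ → H) (n : ℕ), (wordLength (T : Set (WreathZ H)) (walk h n) : ℝ) ≤
      n * τ + C * ∑ j ∈ Finset.range n, (wordLength (S : Set H) (h j) : ℝ) := by
    intro h n
    induction n with
    | zero => simp [walk, wl_one]
    | succ n ih =>
      have h1 := wl_mul_le hT (walk h n) (wrHom H (h n) * wr 1 1)
      have h2 := wl_mul_le hT (wrHom H (h n)) (wr 1 1)
      have h3 : (wordLength (T : Set (WreathZ H)) (walk h (n + 1)) : ℝ) ≤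
          wordLength (T : Set (WreathZ H)) (walk h n) +
          (wordLength (T : Set (WreathZ H)) (wrHom H (h n)) + τ) := by
        rw [hτ]; exact_mod_cast h1.trans (Nat.add_le_add_left h2 _)
      have h4 := hCl (h n)
      rw [Finset.sum_range_succ]
      push_cast
      beta_reduce at h4
      linarith
  refine ⟨5 * τ + C, by positivity, fun g M hx hsupp => ?_⟩
  set x : ℤ := Multiplicative.toAdd g.right with hxdef
  set h : ℕ → H := fun j => (g.left : ℤ → H) ((j : ℤ) - M) with hh
  obtain ⟨k, hk⟩ : ∃ k : ℕ, x - M = -(k : ℤ) := by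
    have := (abs_le.1 hx).2
    exact ⟨(M - x).toNat, by omega⟩
  have hk2 : k ≤ 2 * M := by
    have := (abs_le.1 hx).1
    omega
  have hg : g = wr 1 (-(M : ℤ)) * walk h (2 * M) * wr 1 (-(k : ℤ)) := by
    rw [← wr_eta (walk h (2 * M)), walk_right, ← wr_eta g, ← hxdef, wr_mul, wr_mul, sh_one, mul_one,
      one_mul]
    congr 1
    · apply lamps_ext; intro y
      rw [sh_apply, walk_left]
      split_ifs with hy
      · have e : (((y - -(M : ℤ)).toNat : ℕ) : ℤ) - M = y := by omega
        rw [hh]; beta_reduce; rw [e]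
      · by_contra hne
        have h1 := hsupp y hne
        have h2 := abs_lt.1 (show |y| < (M : ℤ) by omega)
        push_cast at hy
        omega
    · push_cast; omega
  have h1 := wl_mul_le hT (wr 1 (-(M : ℤ)) * walk h (2 * M)) (wr 1 (-(k : ℤ)))
  have h2 := wl_mul_le hT (wr 1 (-(M : ℤ))) (walk h (2 * M))
  rw [← hg] at h1
  have h3 : (wordLength (T : Set (WreathZ H)) g : ℝ) ≤
      wordLength (T : Set (WreathZ H)) (wr 1 (-(M : ℤ)) : WreathZ H) +
      wordLength (T : Set (WreathZ H)) (walk h (2 * M)) +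
      wordLength (T : Set (WreathZ H)) (wr 1 (-(k : ℤ)) : WreathZ H) := by
    exact_mod_cast h1.trans (Nat.add_le_add_right h2 _)
  have h4 := hneg M
  have h5 := hneg k
  have h6 := hwalk h (2 * M)
  have h7 : (k : ℝ) * τ ≤ 2 * M * τ := by
    have : (k : ℝ) ≤ 2 * M := by exact_mod_cast hk2
    gcongr
  have h8 : 0 ≤ ∑ j ∈ Finset.range (2 * M), (wordLength (S : Set H) (h j) : ℝ) := by positivity
  have h9 : (0 : ℝ) ≤ M := by positivity
  push_cast at h6
  change _ ≤ (5 * τ + C) * ((M : ℝ) + ∑ j ∈ Finset.range (2 * M), (wordLength (S : Set H) (h j) : ℝ))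
  nlinarith [mul_nonneg hτ0 h8, mul_nonneg hC.le h9]

lemma exists_M (g : WreathZ H) (hg : g ≠ 1) : ∃ M : ℕ, 1 ≤ M ∧
    |Multiplicative.toAdd g.right| ≤ (M : ℤ) ∧
      (∀ y : ℤ, (g.left : ℤ → H) y ≠ 1 → |y| + 1 ≤ (M : ℤ)) ∧
    ((M : ℤ) ≤ |Multiplicative.toAdd g.right| ∨
          ∃ y : ℤ, (M : ℤ) ≤ |y| + 1 ∧ (g.left : ℤ → H) y ≠ 1) := by
  classical
  have hex : ∃ M : ℕ, |Multiplicative.toAdd g.right| ≤ (M : ℤ) ∧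
      (∀ y : ℤ, (g.left : ℤ → H) y ≠ 1 → |y| + 1 ≤ (M : ℤ)) := by
    obtain ⟨s, hs⟩ := exists_supp g.left
    refine ⟨(Multiplicative.toAdd g.right).natAbs + ∑ y ∈ s, (y.natAbs + 1), ?_, fun y hy => ?_⟩
    · push_cast
      have : (0 : ℤ) ≤ ∑ y ∈ s, (|y| + 1) := Finset.sum_nonneg fun y _ => by positivity
      linarith
    · have hys : y ∈ s := by
        by_contra h; exact hy (hs y h)
      have := Finset.single_le_sum (f := fun y : ℤ => y.natAbs + 1) (fun _ _ => Nat.zero_le _) hys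
      beta_reduce at this
      rw [Int.abs_eq_natAbs]
      have h2 : ((y.natAbs + 1 : ℕ) : ℤ) ≤ ((∑ y ∈ s, (y.natAbs + 1) : ℕ) : ℤ) := by
        exact_mod_cast this
      rw [Nat.cast_add (Multiplicative.toAdd g.right).natAbs]
      push_cast at h2 ⊢
      have h3 : 0 ≤ |Multiplicative.toAdd g.right| := abs_nonneg _
      linarith
  obtain ⟨h1, h2⟩ := Nat.find_spec hex
  set M := Nat.find hex with hM
  have hM1 : 1 ≤ M := by
    by_contra! h0
    have h0' : M = 0 := by omega
    rw [h0'] at h1 h2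
    apply hg
    rw [← wr_eta g, wr_one]
    congr 1
    · apply lamps_ext; intro y
      by_contra hne
      have := h2 y hne
      have := abs_nonneg y
      push_cast at *
      omega
    · have := abs_nonneg (Multiplicative.toAdd g.right)
      exact abs_eq_zero.1 (le_antisymm (by exact_mod_cast h1) this)
  refine ⟨M, hM1, h1, h2, ?_⟩
  by_contra! hcon
  refine Nat.find_min hex (m := M - 1) (by omega) ⟨?_, fun y hy => ?_⟩
  · have := hcon.1
    omega
  · by_contra! h
    exact hy (hcon.2 y (by omega))

lemma lower_two {p a β : ℝ} (hp : 1 ≤ p) {S : Finset H} {T : Finset (WreathZ H)} [Infinite H]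
    (hS : IsSymmGen S) (hT : IsSymmGen T) (hg : GoodExp H S p a) (hβ : 0 < β) (hβa : β < a)
    (hκ : β * (a + (1 - 1 / p)) < a) : GoodExp (WreathZ H) T p β := by
  have hfact : Fact (1 ≤ ENNReal.ofReal p) := ⟨by simpa using hp⟩
  have hp0 : 0 < p := by linarith
  have ha : 0 < a := by linarith
  have ha1 : a ≤ 1 := goodExp_le_one hp hS hg
  have hcount : Countable (WreathZ H) := countable_of_gen hT
  obtain ⟨γ, hγ0, hγ1, hγ, hσ1, hσ2⟩ : ∃ γ : ℝ, 0 ≤ γ ∧ γ ≤ 1 ∧ (γ = 0 ∨ 1 < (1 - γ) * p) ∧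
      β * p ≤ γ * p + 1 ∧ β * (a * p - 1) ≤ (γ * p + 1) * (a - β) := by
    rcases hp.eq_or_lt with rfl | hp1
    · exact ⟨0, le_refl _, zero_le_one, Or.inl rfl, by linarith, by nlinarith⟩
    · have hab : 0 < a - β := by linarith
      have hκ' : β * (a * p + p - 1) < a * p := by
        have := mul_lt_mul_of_pos_right hκ hp0
        have e : β * (a + (1 - 1 / p)) * p = β * (a * p + p - 1) := by field_simp; ring
        rwa [e] at this
      obtain ⟨σ, h1, h2⟩ : ∃ σ : ℝ, max (max 1 (β * p)) (β * (a * p - 1) / (a - β)) ≤ σ ∧ σ < p := by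
        refine ⟨_, le_refl _, max_lt (max_lt hp1 (by nlinarith)) ?_⟩
        rw [div_lt_iff₀ hab]; nlinarith
      have h3 : 1 ≤ σ := le_trans (le_trans (le_max_left _ _) (le_max_left _ _)) h1
      have h4 : β * p ≤ σ := le_trans (le_trans (le_max_right _ _) (le_max_left _ _)) h1
      have h5 : β * (a * p - 1) / (a - β) ≤ σ := le_trans (le_max_right _ _) h1
      rw [div_le_iff₀ hab] at h5
      have e : (σ - 1) / p * p + 1 = σ := by field_simp; ring
      refine ⟨(σ - 1) / p, div_nonneg (by linarith) hp0.le, ?_, Or.inr ?_, ?_, ?_⟩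
      · rw [div_le_one hp0]; linarith
      · have : (1 - (σ - 1) / p) * p = p - σ + 1 := by field_simp; ring
        rw [this]; linarith
      · rw [e]; exact h4
      · rw [e]; exact h5
  obtain ⟨-, ψ, hψ, c, hc, hψc⟩ := hg
  obtain ⟨Ψ₁, hΨ₁, e1⟩ := zpart hp hψ
  obtain ⟨Ψ₂, hΨ₂, e2⟩ := two_sided (H := H) hp (fun n => ((n : ℝ) + 1) ^ γ)
    (weight_sum hp hγ0 hγ1 hγ)
  obtain ⟨Ψ, hΨ, e⟩ := combine hp hΨ₁ hΨ₂
  obtain ⟨C₁, hC₁, hkey⟩ := key_ineq (ι := ℕ) hp hβ hβa hσ1 hσ2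
  obtain ⟨C₂, hC₂, hwl⟩ := wl_bound hS hT
  set σ : ℝ := γ * p + 1 with hσ
  have hσ0 : 0 < σ := by positivity
  set D : ℝ := C₁ * ((c ^ p)⁻¹ + σ) with hD
  have hD0 : 0 < D := by positivity
  refine ⟨hβ.le, Ψ, hΨ, (C₂ ^ β * D ^ (1 / p))⁻¹, by positivity, fun g hg1 => ?_⟩
  obtain ⟨M, hM1, hMx, hMs, hMor⟩ := exists_M g hg1
  set n : ℕ → ℝ := fun j => (wordLength (S : Set H) ((g.left : ℤ → H) ((j : ℤ) - M)) : ℝ) with hn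
  have hn0 : ∀ j, 0 ≤ n j := fun j => by positivity
  set N : ℝ := ‖Ψ g - Ψ 1‖ with hN
  set A := ∑ j ∈ Finset.range (2 * M), n j ^ (a * p) with hA
  have hA0 : 0 ≤ A := Finset.sum_nonneg fun i _ => Real.rpow_nonneg (hn0 i) _
  have hψc' : ∀ h : H, c * (wordLength (S : Set H) h : ℝ) ^ a ≤ ‖ψ h - ψ 1‖ := by
    intro h
    by_cases h1 : h = 1
    · subst h1; rw [wl_one]; simp [Real.zero_rpow ha.ne']
    · exact hψc h h1
  have hen : ‖Ψ g - Ψ 1‖ₑ ^ p = ENNReal.ofReal (N ^ p) := by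
    rw [← ofReal_norm, ENNReal.ofReal_rpow_of_nonneg (norm_nonneg _) hp0.le]
  have b1 : ENNReal.ofReal (c ^ p * A) ≤ ‖Ψ₁ g - Ψ₁ 1‖ₑ ^ p := by
    rw [e1]
    have hinj : Function.Injective (fun j : ℕ => (j : ℤ) - M) := fun i j hij => by
      beta_reduce at hij; omega
    refine le_trans ?_ (ENNReal.tsum_comp_le_tsum_of_injective hinj _)
    refine le_trans ?_ (ENNReal.sum_le_tsum (Finset.range (2 * M)))
    rw [hA, Finset.mul_sum, ENNReal.ofReal_sum_of_nonneg
      (fun i _ => mul_nonneg (by positivity) (Real.rpow_nonneg (hn0 i) _))]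
    apply Finset.sum_le_sum
    intro j _
    rw [← ofReal_norm, ENNReal.ofReal_rpow_of_nonneg (norm_nonneg _) hp0.le]
    apply ENNReal.ofReal_le_ofReal
    rw [Real.rpow_mul (hn0 j), ← Real.mul_rpow hc.le (Real.rpow_nonneg (hn0 j) _)]
    exact Real.rpow_le_rpow (mul_nonneg hc.le (Real.rpow_nonneg (hn0 j) _)) (hψc' _) hp0.le
  have b2 : ENNReal.ofReal ((M : ℝ) ^ σ / σ) ≤ ‖Ψ₂ g - Ψ₂ 1‖ₑ ^ p := by
    refine le_trans ?_ (e2 g M hMor)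
    refine le_trans (ENNReal.ofReal_le_ofReal (sum_lower (by positivity : 0 ≤ γ * p) M)) ?_
    rw [ENNReal.ofReal_sum_of_nonneg (fun i _ => by positivity)]
    apply Finset.sum_le_sum
    intro j _
    rw [Real.enorm_eq_ofReal_abs, abs_of_nonneg (by positivity),
      ENNReal.ofReal_rpow_of_nonneg (by positivity) hp0.le, ← Real.rpow_mul (by positivity)]
  have b3 : ENNReal.ofReal (c ^ p * A) ≤ ENNReal.ofReal (N ^ p) := by
    rw [← hen, e g]; exact b1.trans le_self_add
  have b4 : ENNReal.ofReal ((M : ℝ) ^ σ / σ) ≤ ENNReal.ofReal (N ^ p) := by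
    rw [← hen, e g]; exact b2.trans le_add_self
  have hNp : 0 ≤ N ^ p := Real.rpow_nonneg (norm_nonneg _) _
  rw [ENNReal.ofReal_le_ofReal_iff hNp] at b3 b4
  rw [div_le_iff₀ hσ0] at b4
  have b5 : A ≤ (c ^ p)⁻¹ * N ^ p := by
    rw [le_inv_mul_iff₀ (by positivity)]; exact b3
  have hk := hkey (Finset.range (2 * M)) n M hn0 (by exact_mod_cast hM1) (by simp)
  have hw := hwl g M hMx hMs
  set L : ℝ := M + ∑ j ∈ Finset.range (2 * M), n j with hL
  have hL0 : 0 ≤ L := add_nonneg (by positivity) (Finset.sum_nonneg fun i _ => hn0 i)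
  have b6 : L ^ (β * p) ≤ D * N ^ p := by
    refine hk.trans ?_
    rw [hD, mul_assoc]
    apply mul_le_mul_of_nonneg_left _ hC₁.le
    linarith
  have b7 : L ^ β ≤ D ^ (1 / p) * N := by
    have := Real.rpow_le_rpow (by positivity) b6 (by positivity : 0 ≤ 1 / p)
    rw [← Real.rpow_mul hL0, Real.mul_rpow hD0.le hNp, ← Real.rpow_mul (norm_nonneg _),
      mul_one_div_cancel hp0.ne', Real.rpow_one, mul_assoc, mul_one_div_cancel hp0.ne', mul_one] at this
    exact this
  rw [inv_mul_le_iff₀ (by positivity)]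
  calc (wordLength (T : Set (WreathZ H)) g : ℝ) ^ β ≤ (C₂ * L) ^ β :=
        Real.rpow_le_rpow (by positivity) hw hβ.le
    _ = C₂ ^ β * L ^ β := Real.mul_rpow hC₂.le hL0
    _ ≤ C₂ ^ β * (D ^ (1 / p) * N) := by gcongr
    _ = _ := by ring

theorem final (p : ℝ) (hp1 : 1 ≤ p) (hp2 : p ≤ 2) (H : Type) [Group H] [Infinite H]
    (S₀ : Finset H) (hS₀ : IsSymmGen S₀) (T : Finset (WreathZ H)) (hT : IsSymmGen T) :
    alphaSharp (WreathZ H) (T : Set (WreathZ H)) p =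
      min (alphaSharp H S₀ p / (alphaSharp H S₀ p + (1 - 1 / p))) (alphaSharp H S₀ p) := by
  have hfact : Fact (1 ≤ ENNReal.ofReal p) := ⟨by simpa using hp1⟩
  have hp0 : 0 < p := by linarith
  have hκ : 0 ≤ 1 - 1 / p := by
    rw [sub_nonneg, div_le_one hp0]; exact hp1
  set α := alphaSharp H S₀ p with hα
  have hα0 : 0 ≤ α := alphaSharp_nonneg hp1
  apply le_antisymm
  · by_contra! hlt
    have hm0 : 0 ≤ min (α / (α + (1 - 1 / p))) α := le_min (by positivity) hα0
    obtain ⟨b, hb, hgb⟩ := exists_good_of_lt hp1 hT hm0 hlt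
    have hgH := good_lamp hS₀ hT hgb
    have hbα : b ≤ α := le_alphaSharp hp1 hS₀ hgH
    have hb0 : 0 < b := lt_of_le_of_lt hm0 hb
    have hαpos : 0 < α := by linarith
    have hr : b ≤ α / (α + (1 - 1 / p)) := by
      rw [le_div_iff₀ (by linarith)]
      rcases hp1.eq_or_lt with h | h
      · have := goodExp_le_one hp1 hT hgb
        rw [← h]
        norm_num
        nlinarith
      · exact upper_two h hp2 hS₀ hT hgb
    exact absurd (lt_of_lt_of_le hb (le_min hr hbα)) (lt_irrefl _)
  · by_contra! hlt
    obtain ⟨β, h1, h2⟩ := exists_between hlt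
    have hβ0 : 0 < β := lt_of_le_of_lt (alphaSharp_nonneg hp1) h1
    have hβα : β < α := lt_of_lt_of_le h2 (min_le_right _ _)
    have hβr : β < α / (α + (1 - 1 / p)) := lt_of_lt_of_le h2 (min_le_left _ _)
    have hαpos : 0 < α := by linarith
    rw [lt_div_iff₀ (by linarith)] at hβr
    have hβ1 : 0 < 1 - β := by
      by_contra! hcon
      nlinarith [mul_nonneg hβ0.le hκ]
    have hlt2 : max β (β * (1 - 1 / p) / (1 - β)) < α := by
      refine max_lt hβα ?_
      rw [div_lt_iff₀ hβ1]
      nlinarith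
    obtain ⟨a, ha, hga⟩ := exists_good_of_lt hp1 hS₀ (le_trans hβ0.le (le_max_left _ _)) hlt2
    have ha1 : β < a := lt_of_le_of_lt (le_max_left _ _) ha
    have ha2 : β * (1 - 1 / p) / (1 - β) < a := lt_of_le_of_lt (le_max_right _ _) ha
    rw [div_lt_iff₀ hβ1] at ha2
    have hG := lower_two hp1 hS₀ hT hga hβ0 ha1 (by nlinarith)
    exact absurd (lt_of_le_of_lt (le_alphaSharp hp1 hT hG) h1) (lt_irrefl _)
end Lower2

/-- Since the compression exponents do not depend on the choice of the
finite symmetric generating sets, they are quantified universally here. -/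
theorem statement11 (p : ℝ) (hp1 : 1 ≤ p) (hp2 : p ≤ 2)
    (H : Type) [Group H] [Infinite H]
    (S₀ : Finset H) (hS₀ : IsSymmGen S₀)
    (T : Finset (WreathZ H)) (hT : IsSymmGen T) :
    alphaSharp (WreathZ H) (T : Set (WreathZ H)) p =
      min (alphaSharp H (S₀ : Set H) p /
            (alphaSharp H (S₀ : Set H) p + (1 - 1 / p)))
          (alphaSharp H (S₀ : Set H) p) := by
  exact final p hp1 hp2 H S₀ hS₀ T hT

end
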